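/- arXiv:2512.22595 — 2 statements merged into one kernel-verified Lean document; each statement's English description precedes it below -/
import Mathlib

section
/- Let (R, m, k) be a noetherian local ring and M a nonzero finitely generated R-module of finite projective dimension with minimal free resolution F. Then F is self-dual (i.e., F ≅ Hom_R(F,R) as complexes, suitably indexed) if and only if M is totally self-dual. -/
open CategoryTheory IsLocalRing

noncomputable def ExtMod (R : Type) [CommRing R] (M N : Type) [AddCommGroup M] [Module R M]
    [AddCommGroup N] [Module R N] (i : ℕ) : ModuleCat R :=
  ((Ext R (ModuleCat.{0} R) i).obj (Opposite.op (ModuleCat.of R M))).obj (ModuleCat.of R N)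

noncomputable def mgrade (R : Type) [CommRing R] (M : Type) [AddCommGroup M] [Module R M] : ℕ :=
  sInf {i | Nontrivial (ExtMod R M R i)}

def IsTotallySelfDual (R : Type) [CommRing R] (M : Type) [AddCommGroup M] [Module R M] : Prop :=
  Nontrivial M ∧ Nonempty (ExtMod R M R (mgrade R M) ≃ₗ[R] M) ∧
    ∀ i, i ≠ mgrade R M → Subsingleton (ExtMod R M R i)

/-- A minimal free resolution of `M` over a local ring `R`: a resolution by finite free
modules all of whose differentials (and the augmentation) have image inside `𝔪`-times
the target (resp. have kernel inside `𝔪 F₀`). -/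
structure MinFreeRes (R : Type) [CommRing R] [IsLocalRing R]
    (M : Type) [AddCommGroup M] [Module R M] where
  F : ℕ → ModuleCat.{0} R
  free : ∀ n, Module.Free R (F n)
  fin : ∀ n, Module.Finite R (F n)
  d : ∀ n, F (n + 1) →ₗ[R] F n
  aug : F 0 →ₗ[R] M
  aug_surj : Function.Surjective aug
  exact_aug : LinearMap.ker aug = LinearMap.range (d 0)
  exact : ∀ n, LinearMap.ker (d n) = LinearMap.range (d (n + 1))
  minimal : ∀ n, LinearMap.range (d n) ≤ (maximalIdeal R) • (⊤ : Submodule R (F n))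

namespace MinFreeRes

variable {R : Type} [CommRing R] [IsLocalRing R]
  {M : Type} [AddCommGroup M] [Module R M]

/-- The `n`-th syzygy of `M` with respect to a minimal free resolution:
`Ω⁰ M = M` and `Ωⁿ⁺¹ M = Im(dₙ) = Ker(dₙ₋₁)`. -/
noncomputable def Syz (C : MinFreeRes R M) : ℕ → ModuleCat.{0} R
  | 0 => ModuleCat.of R M
  | n + 1 => ModuleCat.of R (LinearMap.range (C.d n))

/-- A minimal free resolution is self-dual if it is bounded, of length `r`, and is
isomorphic (as a complex) to its `R`-dual complex with reversed indexing. -/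
def SelfDual (C : MinFreeRes R M) : Prop :=
  ∃ r : ℕ, (∀ n, r < n → Subsingleton (C.F n)) ∧ Nontrivial (C.F r) ∧
    ∃ e : ∀ ⦃m n : ℕ⦄, m + n = r → (C.F n ≃ₗ[R] Module.Dual R (C.F m)),
      ∀ (q n : ℕ) (hp : (q + 1) + n = r) (hq : q + (n + 1) = r),
        (e hp).toLinearMap ∘ₗ C.d n = (C.d q).dualMap ∘ₗ (e hq).toLinearMap

/-- A minimal free resolution is eventually periodic with period `a` if
`Ωⁿ M ≅ Ωⁿ⁺ᵃ M` for some `n`. -/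
def EventuallyPeriodic (C : MinFreeRes R M) (a : ℕ) : Prop :=
  0 < a ∧ ∃ n : ℕ, Nonempty (C.Syz n ≃ₗ[R] C.Syz (n + a))

end MinFreeRes

/-- Stable isomorphism: `X ⊕ P ≅ Y ⊕ Q` for some finite free `P`, `Q`. -/
def StablyIso (R : Type) [CommRing R] (X Y : Type) [AddCommGroup X] [Module R X]
    [AddCommGroup Y] [Module R Y] : Prop :=
  ∃ (P Q : ModuleCat.{0} R), Module.Free R P ∧ Module.Finite R P ∧
    Module.Free R Q ∧ Module.Finite R Q ∧ Nonempty ((X × P) ≃ₗ[R] (Y × Q))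

namespace MinFreeRes

variable {R : Type} [CommRing R] [IsLocalRing R] {M : Type} [AddCommGroup M] [Module R M]

lemma d_comp_d (C : MinFreeRes R M) (n : ℕ) : C.d n ∘ₗ C.d (n + 1) = 0 :=
  LinearMap.range_le_ker_iff.1 (C.exact n).ge

/-- The chain complex underlying a minimal free resolution. -/
noncomputable def complex (C : MinFreeRes R M) : ChainComplex (ModuleCat.{0} R) ℕ :=
  ChainComplex.of C.F (fun n => ModuleCat.ofHom (C.d n)) fun n => by
    rw [← ModuleCat.ofHom_comp, C.d_comp_d]; rfl

lemma complex_d (C : MinFreeRes R M) (n : ℕ) :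
    C.complex.d (n + 1) n = ModuleCat.ofHom (C.d n) := by
  simp [complex]

/-- The augmentation as a morphism out of the degree zero term of the complex. -/
noncomputable def complexAug (C : MinFreeRes R M) : C.complex.X 0 ⟶ ModuleCat.of R M :=
  ModuleCat.ofHom C.aug

lemma complex_d_comp_complexAug (C : MinFreeRes R M) : C.complex.d 1 0 ≫ C.complexAug = 0 := by
  have h : C.aug ∘ₗ C.d 0 = 0 := LinearMap.range_le_ker_iff.1 C.exact_aug.ge
  rw [C.complex_d 0]
  exact (ModuleCat.ofHom_comp _ _).symm.trans (congrArg ModuleCat.ofHom h)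

lemma complex_exactAt_succ (C : MinFreeRes R M) (n : ℕ) : C.complex.ExactAt (n + 1) := by
  rw [HomologicalComplex.exactAt_iff' _ (n + 1 + 1) (n + 1) n (by simp) (by simp)]
  rw [ShortComplex.moduleCat_exact_iff_range_eq_ker]
  change LinearMap.range (C.complex.d (n + 1 + 1) (n + 1)).hom =
    LinearMap.ker (C.complex.d (n + 1) n).hom
  rw [C.complex_d, C.complex_d]
  exact (C.exact n).symm

/-- The augmentation as a chain map to the complex concentrated in degree zero. -/
noncomputable def complexπ (C : MinFreeRes R M) :
    C.complex ⟶ (ChainComplex.single₀ (ModuleCat R)).obj (ModuleCat.of R M) :=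
  (ChainComplex.toSingle₀Equiv _ _).symm ⟨C.complexAug, C.complex_d_comp_complexAug⟩

lemma complexπ_f_zero (C : MinFreeRes R M) : C.complexπ.f 0 = C.complexAug :=
  ChainComplex.toSingle₀Equiv_symm_apply_f_zero _ C.complex_d_comp_complexAug

lemma quasiIsoAt_complexπ_zero (C : MinFreeRes R M) : QuasiIsoAt C.complexπ 0 := by
  rw [ChainComplex.quasiIsoAt₀_iff,
    ShortComplex.quasiIso_iff_of_zeros' _ (by rfl) (by rfl) (by rfl)]
  constructor
  · rw [ShortComplex.moduleCat_exact_iff_range_eq_ker]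
    change LinearMap.range (C.complex.d 1 0).hom = LinearMap.ker (C.complexπ.f 0).hom
    rw [C.complex_d 0, C.complexπ_f_zero]
    exact C.exact_aug.symm
  · change Epi (C.complexπ.f 0)
    rw [C.complexπ_f_zero]
    exact (ModuleCat.epi_iff_surjective _).2 C.aug_surj

/-- A minimal free resolution as a projective resolution in `ModuleCat R`. -/
noncomputable def projectiveResolution (C : MinFreeRes R M) :
    ProjectiveResolution (ModuleCat.of R M) where
  complex := C.complex
  projective n := by
    have := C.free n
    exact (IsProjective.iff_projective (C.F n)).1 inferInstance
  π := C.complexπ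
  quasiIso := ⟨fun n => by
    cases n with
    | zero => exact C.quasiIsoAt_complexπ_zero
    | succ n =>
      rw [quasiIsoAt_iff_exactAt']
      · exact C.complex_exactAt_succ n
      · apply ChainComplex.exactAt_succ_single_obj⟩

/-- The submodule of coboundaries in degree `n` of the `R`-dual of a resolution. -/
noncomputable def dualBoundaries (C : MinFreeRes R M) :
    ∀ n, Submodule R (Module.Dual R (C.F n))
  | 0 => ⊥
  | n + 1 => LinearMap.range (C.d n).dualMap

/-- Morphisms from the terms of the complex to `R` are linear forms. -/
noncomputable def yonedaEquiv (C : MinFreeRes R M) (n : ℕ) :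
    (C.complex.linearYonedaObj R (ModuleCat.of R R)).X n ≃ₗ[R] Module.Dual R (C.F n) :=
  ModuleCat.homLinearEquiv (S := R) (M := C.F n) (N := ModuleCat.of R R)

lemma yonedaEquiv_d (C : MinFreeRes R M) (n : ℕ)
    (x : (C.complex.linearYonedaObj R (ModuleCat.of R R)).X n) :
    C.yonedaEquiv (n + 1) ((C.complex.linearYonedaObj R (ModuleCat.of R R)).d n (n + 1) x) =
      (C.d n).dualMap (C.yonedaEquiv n x) := by
  rw [ChainComplex.linearYonedaObj_d]
  change ModuleCat.Hom.hom (C.complex.d (n + 1) n ≫ x) = _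
  rw [C.complex_d]
  rfl

end MinFreeRes

lemma ShortComplex.exists_ker_linearMap_homology_of_moduleCat {R : Type} [CommRing R]
    (S : ShortComplex (ModuleCat.{0} R)) :
    ∃ p : LinearMap.ker S.g.hom →ₗ[R] S.homology, Function.Surjective p ∧
      LinearMap.ker p = (LinearMap.range S.f.hom).submoduleOf (LinearMap.ker S.g.hom) := by
  let e : S.homology ≃ₗ[R] LinearMap.ker S.g.hom ⧸ LinearMap.range S.moduleCatToCycles :=
    S.moduleCatHomologyIso.toLinearEquiv
  refine ⟨e.symm.toLinearMap ∘ₗ Submodule.mkQ _,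
    e.symm.surjective.comp (Submodule.mkQ_surjective _), ?_⟩
  refine ((LinearEquiv.ker_comp _ _).trans (Submodule.ker_mkQ _)).trans ?_
  ext x
  constructor
  · rintro ⟨y, rfl⟩
    exact ⟨y, rfl⟩
  · rintro ⟨y, hy⟩
    exact ⟨y, Subtype.ext hy⟩

/-- The homology of a short complex of modules, transported along linear equivalences. -/
lemma ShortComplex.exists_ker_linearMap_homology {R : Type} [CommRing R]
    (S : ShortComplex (ModuleCat.{0} R)) {A B D : Type} [AddCommGroup A] [AddCommGroup B]
    [AddCommGroup D] [Module R A] [Module R B] [Module R D] (f : A →ₗ[R] B) (g : B →ₗ[R] D)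
    (eA : S.X₁ ≃ₗ[R] A) (eB : S.X₂ ≃ₗ[R] B) (eD : S.X₃ ≃ₗ[R] D)
    (hf : ∀ x, eB (S.f x) = f (eA x)) (hg : ∀ x, eD (S.g x) = g (eB x)) :
    ∃ p : LinearMap.ker g →ₗ[R] S.homology, Function.Surjective p ∧
      LinearMap.ker p = (LinearMap.range f).submoduleOf (LinearMap.ker g) := by
  have hgf : g ∘ₗ f = 0 := by
    ext x
    obtain ⟨y, rfl⟩ := eA.surjective x
    simp [← hf, ← hg]
  let T := ShortComplex.moduleCatMk f g hgf
  let i : S ≅ T := ShortComplex.isoMk eA.toModuleIso eB.toModuleIso eD.toModuleIso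
    (by ext x; exact (hf x).symm) (by ext x; exact (hg x).symm)
  let e : T.homology ≃ₗ[R] S.homology := (ShortComplex.homologyMapIso i).symm.toLinearEquiv
  obtain ⟨p, hp, hk⟩ := ShortComplex.exists_ker_linearMap_homology_of_moduleCat T
  exact ⟨e.toLinearMap ∘ₗ p, e.surjective.comp hp, (LinearEquiv.ker_comp _ _).trans hk⟩

namespace MinFreeRes

variable {R : Type} [CommRing R] [IsLocalRing R] {M : Type} [AddCommGroup M] [Module R M]

lemma exists_ker_linearMap_extMod (C : MinFreeRes R M) (n : ℕ) :
    ∃ p : LinearMap.ker (C.d n).dualMap →ₗ[R] ExtMod R M R n, Function.Surjective p ∧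
      LinearMap.ker p = (C.dualBoundaries n).submoduleOf (LinearMap.ker (C.d n).dualMap) := by
  let K := C.complex.linearYonedaObj R (ModuleCat.of R R)
  let e : ExtMod R M R n ≃ₗ[R] K.homology n :=
    (C.projectiveResolution.isoExt (R := R) n (ModuleCat.of R R)).toLinearEquiv
  suffices h : ∃ p : LinearMap.ker (C.d n).dualMap →ₗ[R] K.homology n, Function.Surjective p ∧
      LinearMap.ker p = (C.dualBoundaries n).submoduleOf (LinearMap.ker (C.d n).dualMap) by
    obtain ⟨p, hp, hk⟩ := h
    exact ⟨e.symm.toLinearMap ∘ₗ p, e.symm.surjective.comp hp, by rw [LinearEquiv.ker_comp, hk]⟩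
  cases n with
  | zero =>
    let i : K.homology 0 ≃ₗ[R] (K.sc' 0 0 1).homology :=
      (ShortComplex.homologyMapIso (K.isoSc' 0 0 1 (by simp) (by simp))).toLinearEquiv
    obtain ⟨p, hp, hk⟩ := ShortComplex.exists_ker_linearMap_homology (K.sc' 0 0 1)
      0 (C.d 0).dualMap
      (C.yonedaEquiv 0) (C.yonedaEquiv 0) (C.yonedaEquiv 1)
      (fun x => by
        change C.yonedaEquiv 0 (K.d 0 0 x) = 0
        rw [K.shape 0 0 (by simp)]
        exact map_zero (C.yonedaEquiv 0))
      (C.yonedaEquiv_d 0)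
    rw [LinearMap.range_zero] at hk
    exact ⟨i.symm.toLinearMap ∘ₗ p, i.symm.surjective.comp hp,
      (LinearEquiv.ker_comp _ _).trans hk⟩
  | succ n =>
    let i : K.homology (n + 1) ≃ₗ[R] (K.sc' n (n + 1) (n + 1 + 1)).homology :=
      (ShortComplex.homologyMapIso
      (K.isoSc' n (n + 1) (n + 1 + 1) (by simp) (by simp))).toLinearEquiv
    obtain ⟨p, hp, hk⟩ := ShortComplex.exists_ker_linearMap_homology
      (K.sc' n (n + 1) (n + 1 + 1)) (C.d n).dualMap (C.d (n + 1)).dualMap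
      (C.yonedaEquiv _) (C.yonedaEquiv _) (C.yonedaEquiv _)
      (C.yonedaEquiv_d _) (C.yonedaEquiv_d _)
    exact ⟨i.symm.toLinearMap ∘ₗ p, i.symm.surjective.comp hp,
      (LinearEquiv.ker_comp _ _).trans hk⟩

end MinFreeRes

section MinimalCovers

variable {R : Type} [CommRing R]

lemma LinearMap.nonempty_linearEquiv_of_ker_eq {F A B : Type} [AddCommGroup F] [Module R F]
    [AddCommGroup A] [Module R A] [AddCommGroup B] [Module R B] (p : F →ₗ[R] A) (q : F →ₗ[R] B)
    (hp : Function.Surjective p) (hq : Function.Surjective q)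
    (h : LinearMap.ker p = LinearMap.ker q) : Nonempty (A ≃ₗ[R] B) :=
  ⟨(p.quotKerEquivOfSurjective hp).symm.trans
    ((Submodule.quotEquivOfEq _ _ h).trans (q.quotKerEquivOfSurjective hq))⟩

lemma Module.Dual.mem_smul_top_of_forall_mem {F : Type} [AddCommGroup F] [Module R F]
    [Module.Free R F] [Module.Finite R F] (I : Ideal R) (f : Module.Dual R F)
    (hf : ∀ x, f x ∈ I) : f ∈ I • (⊤ : Submodule R (Module.Dual R F)) := by
  let b := Module.Free.chooseBasis R F
  rw [← b.sum_dual_apply_smul_coord f]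
  exact Submodule.sum_mem _ fun i _ => Submodule.smul_mem_smul (hf _) trivial

lemma LinearMap.exists_comp_eq_of_range_le {F F' N : Type}
    [AddCommGroup F] [Module R F] [Module.Free R F] [AddCommGroup F'] [Module R F']
    [AddCommGroup N] [Module R N] (p : F →ₗ[R] N) (p' : F' →ₗ[R] N)
    (hr : LinearMap.range p ≤ LinearMap.range p') : ∃ f : F →ₗ[R] F', p' ∘ₗ f = p := by
  obtain ⟨f, hf⟩ := Module.projective_lifting_property p'.rangeRestrict
    (p.codRestrict (LinearMap.range p') fun x => hr ⟨x, rfl⟩) p'.surjective_rangeRestrict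
  refine ⟨f, LinearMap.ext fun x => ?_⟩
  exact congrArg Subtype.val (LinearMap.congr_fun hf x)

variable [IsLocalRing R]

lemma LinearMap.surjective_of_comp_eq_of_ker_le {F F' N : Type}
    [AddCommGroup F] [Module R F] [AddCommGroup F'] [Module R F'] [Module.Finite R F']
    [AddCommGroup N] [Module R N] (p : F →ₗ[R] N) (p' : F' →ₗ[R] N) (f : F →ₗ[R] F')
    (hf : p' ∘ₗ f = p) (hr : LinearMap.range p' ≤ LinearMap.range p)
    (hk : LinearMap.ker p' ≤ maximalIdeal R • (⊤ : Submodule R F')) :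
    Function.Surjective f := by
  rw [← LinearMap.range_eq_top, ← top_le_iff]
  refine Submodule.le_of_le_smul_of_le_jacobson_bot Module.Finite.fg_top
    (IsLocalRing.maximalIdeal_le_jacobson _) fun x _ => ?_
  obtain ⟨y, hy⟩ := hr ⟨x, rfl⟩
  have hx : x - f y ∈ LinearMap.ker p' := by
    simp [← hy, ← hf]
  exact Submodule.mem_sup.2 ⟨f y, ⟨y, rfl⟩, x - f y, hk hx, by simp⟩

/-- Two minimal free covers of the same module are isomorphic over it. -/
lemma LinearMap.exists_linearEquiv_of_ker_le [IsNoetherianRing R] {F F' N : Type}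
    [AddCommGroup F] [Module R F] [Module.Free R F] [Module.Finite R F]
    [AddCommGroup F'] [Module R F'] [Module.Free R F'] [Module.Finite R F']
    [AddCommGroup N] [Module R N] (p : F →ₗ[R] N) (p' : F' →ₗ[R] N)
    (hr : LinearMap.range p = LinearMap.range p')
    (hk : LinearMap.ker p ≤ maximalIdeal R • (⊤ : Submodule R F))
    (hk' : LinearMap.ker p' ≤ maximalIdeal R • (⊤ : Submodule R F')) :
    ∃ e : F ≃ₗ[R] F', ∀ x, p' (e x) = p x := by
  obtain ⟨f, hf⟩ := p.exists_comp_eq_of_range_le p' hr.le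
  obtain ⟨g, hg⟩ := p'.exists_comp_eq_of_range_le p hr.ge
  have hfs := p.surjective_of_comp_eq_of_ker_le p' f hf hr.ge hk'
  have hgs := p'.surjective_of_comp_eq_of_ker_le p g hg hr.le hk
  have hinj : Function.Injective (g ∘ₗ f) :=
    IsNoetherian.injective_of_surjective_endomorphism _ (hgs.comp hfs)
  have hfi : Function.Injective f := Function.Injective.of_comp hinj
  exact ⟨LinearEquiv.ofBijective f ⟨hfi, hfs⟩, fun x => LinearMap.congr_fun hf x⟩

end MinimalCovers

lemma mgrade_eq_of_forall_subsingleton {R : Type} [CommRing R] {M : Type} [AddCommGroup M]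
    [Module R M] {r : ℕ} (h : Nontrivial (ExtMod R M R r))
    (h' : ∀ i, i ≠ r → Subsingleton (ExtMod R M R i)) : mgrade R M = r := by
  have hs : {i | Nontrivial (ExtMod R M R i)} = {r} := by
    ext i
    refine ⟨fun hi => ?_, fun hi => hi ▸ h⟩
    by_contra hne
    exact not_subsingleton_iff_nontrivial.2 hi (h' i hne)
  rw [mgrade, hs, csInf_singleton]

namespace MinFreeRes

variable {R : Type} [CommRing R] [IsLocalRing R] {M : Type} [AddCommGroup M] [Module R M]

lemma dualBoundaries_le_ker (C : MinFreeRes R M) (n : ℕ) :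
    C.dualBoundaries n ≤ LinearMap.ker (C.d n).dualMap := by
  cases n with
  | zero => exact bot_le
  | succ n =>
    rintro _ ⟨f, rfl⟩
    rw [LinearMap.mem_ker]
    ext x
    have h : C.d n (C.d (n + 1) x) = 0 := LinearMap.congr_fun (C.d_comp_d n) x
    simp [h]

lemma dualBoundaries_le_smul_top (C : MinFreeRes R M) (n : ℕ) :
    C.dualBoundaries n ≤ maximalIdeal R • (⊤ : Submodule R (Module.Dual R (C.F n))) := by
  have := C.free n
  have := C.fin n
  cases n with
  | zero => exact bot_le
  | succ n =>
    rintro _ ⟨f, rfl⟩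
    refine Module.Dual.mem_smul_top_of_forall_mem _ _ fun x => ?_
    have hx : f (C.d n x) ∈ Submodule.map f (maximalIdeal R • (⊤ : Submodule R (C.F n))) :=
      ⟨_, C.minimal n ⟨x, rfl⟩, rfl⟩
    rw [Submodule.map_smul''] at hx
    exact Ideal.mul_le_left (J := Submodule.map f ⊤) hx

lemma subsingleton_extMod_iff (C : MinFreeRes R M) (n : ℕ) :
    Subsingleton (ExtMod R M R n) ↔ LinearMap.ker (C.d n).dualMap ≤ C.dualBoundaries n := by
  obtain ⟨p, hp, hk⟩ := C.exists_ker_linearMap_extMod n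
  rw [← Submodule.submoduleOf_eq_top, ← hk, LinearMap.ker_eq_top]
  constructor
  · intro h
    exact LinearMap.ext fun x => Subsingleton.elim _ _
  · rintro rfl
    exact subsingleton_of_forall_eq 0 fun y => by
      obtain ⟨x, rfl⟩ := hp y
      rfl

lemma ker_dualMap_eq_top (C : MinFreeRes R M) {n : ℕ} (h : Subsingleton (C.F (n + 1))) :
    LinearMap.ker (C.d n).dualMap = ⊤ :=
  LinearMap.ker_eq_top.2 <| LinearMap.ext fun f => LinearMap.ext fun x => by
    simp [Subsingleton.elim x 0]

/-- In the top degree, `Ext` is a quotient of the dual of the last term of the resolution. -/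
lemma exists_dual_linearMap_extMod (C : MinFreeRes R M) {n : ℕ}
    (h : Subsingleton (C.F (n + 1))) :
    ∃ p : Module.Dual R (C.F n) →ₗ[R] ExtMod R M R n, Function.Surjective p ∧
      LinearMap.ker p = C.dualBoundaries n := by
  obtain ⟨p, hp, hk⟩ := C.exists_ker_linearMap_extMod n
  have htop := C.ker_dualMap_eq_top h
  refine ⟨p ∘ₗ LinearMap.id.codRestrict _ fun x => htop.ge trivial, fun y => ?_, ?_⟩
  · obtain ⟨x, rfl⟩ := hp y
    exact ⟨x, rfl⟩
  · rw [LinearMap.ker_comp, hk]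
    rfl

theorem SelfDual.isTotallySelfDual [Nontrivial M] {C : MinFreeRes R M} (h : C.SelfDual) :
    IsTotallySelfDual R M := by
  obtain ⟨r, hr, -, e, he⟩ := h
  have he' : ∀ (q n : ℕ) (hp : (q + 1) + n = r) (hq : q + (n + 1) = r) (x : C.F (n + 1)),
      e hp (C.d n x) = (C.d q).dualMap (e hq x) :=
    fun q n hp hq x => LinearMap.congr_fun (he q n hp hq) x
  have hsub : ∀ i, i ≠ r → Subsingleton (ExtMod R M R i) := by
    intro i hi
    rw [C.subsingleton_extMod_iff]
    rcases hi.lt_or_gt with hi | hi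
    · intro f hf
      obtain ⟨n, hn⟩ : ∃ n, i + (n + 1) = r := ⟨r - i - 1, by omega⟩
      obtain ⟨y, rfl⟩ := (e hn).surjective f
      rw [LinearMap.mem_ker, ← he' i n (by omega) hn, LinearEquiv.map_eq_zero_iff] at hf
      obtain ⟨z, rfl⟩ := (C.exact n).le hf
      cases i with
      | zero =>
        have := hr (n + 1 + 1) (by omega)
        simp [Subsingleton.elim z 0]
      | succ j => exact ⟨_, (he' j (n + 1) hn (by omega) z).symm⟩
    · have := hr i hi
      intro f _
      rw [show f = 0 from LinearMap.ext fun x => by simp [Subsingleton.elim x 0]]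
      exact zero_mem _
  obtain ⟨p, hp, hk⟩ := C.exists_dual_linearMap_extMod (hr (r + 1) (by omega))
  have hker : LinearMap.ker (p ∘ₗ (e (Nat.add_zero r)).toLinearMap) = LinearMap.ker C.aug := by
    rw [LinearMap.ker_comp, hk, C.exact_aug]
    ext x
    cases r with
    | zero =>
      have := hr 1 (by omega)
      constructor
      · intro hx
        rw [(LinearEquiv.map_eq_zero_iff _).1 (show e _ x = 0 from hx)]
        exact zero_mem _
      · rintro ⟨y, rfl⟩
        simp [Subsingleton.elim y 0]
    | succ j =>
      constructor
      · rintro ⟨f, hf⟩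
        obtain ⟨y, rfl⟩ := (e (m := j) (n := 0 + 1) rfl).surjective f
        rw [← he' j 0 rfl] at hf
        exact ⟨y, (e _).injective hf⟩
      · rintro ⟨y, rfl⟩
        exact ⟨_, (he' j 0 rfl rfl y).symm⟩
  obtain ⟨eM⟩ := LinearMap.nonempty_linearEquiv_of_ker_eq _ C.aug
    (hp.comp (e (Nat.add_zero r)).surjective) C.aug_surj hker
  have hg : mgrade R M = r := mgrade_eq_of_forall_subsingleton eM.toEquiv.nontrivial hsub
  exact ⟨inferInstance, hg ▸ ⟨eM⟩, hg ▸ hsub⟩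

/-- The length of a bounded minimal free resolution of a nonzero module. -/
lemma exists_length [Nontrivial M] (C : MinFreeRes R M)
    (hfin : ∃ r : ℕ, ∀ n, r < n → Subsingleton (C.F n)) :
    ∃ r : ℕ, (∀ n, r < n → Subsingleton (C.F n)) ∧ Nontrivial (C.F r) := by
  classical
  refine ⟨Nat.find hfin, Nat.find_spec hfin, ?_⟩
  rcases h : Nat.find hfin with _ | r
  · exact C.aug_surj.nontrivial
  · rw [← not_subsingleton_iff_nontrivial]
    intro hs
    refine Nat.find_min hfin (m := r) (by omega) fun n hn => ?_
    rcases Nat.eq_or_lt_of_le hn with rfl | hn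
    · exact hs
    · exact Nat.find_spec hfin n (by omega)

lemma nontrivial_extMod_of_length (C : MinFreeRes R M) {r : ℕ}
    (hr : ∀ n, r < n → Subsingleton (C.F n)) (hn : Nontrivial (C.F r)) :
    Nontrivial (ExtMod R M R r) := by
  have := C.free r
  have := C.fin r
  rw [← not_subsingleton_iff_nontrivial, C.subsingleton_extMod_iff,
    C.ker_dualMap_eq_top (hr _ r.lt_succ_self)]
  intro h
  have hbot : (⊤ : Submodule R (Module.Dual R (C.F r))) = ⊥ :=
    Submodule.eq_bot_of_le_smul_of_le_jacobson_bot _ _ Module.Finite.fg_top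
      (h.trans (C.dualBoundaries_le_smul_top r)) (IsLocalRing.maximalIdeal_le_jacobson _)
  obtain ⟨x, hx⟩ := exists_ne (0 : C.F r)
  refine hx ((Module.forall_dual_apply_eq_zero_iff R x).1 fun f => ?_)
  rw [(Submodule.mem_bot R).1 (hbot.le (Submodule.mem_top (x := f)))]
  rfl

/-- Extend the comparison of a minimal free resolution with its dual by one degree. -/
lemma exists_linearEquiv_dual_succ [IsNoetherianRing R] (C : MinFreeRes R M) (n m : ℕ)
    (hm : Subsingleton (ExtMod R M R m)) (e : C.F n ≃ₗ[R] Module.Dual R (C.F (m + 1)))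
    (he : (LinearMap.range (C.d n)).map e.toLinearMap = C.dualBoundaries (m + 1)) :
    ∃ e' : C.F (n + 1) ≃ₗ[R] Module.Dual R (C.F m),
      (LinearMap.range (C.d (n + 1))).map e'.toLinearMap = C.dualBoundaries m ∧
        ∀ x, e (C.d n x) = (C.d m).dualMap (e' x) := by
  have := C.free (n + 1)
  have := C.fin (n + 1)
  have := C.free m
  have := C.fin m
  have hker : LinearMap.ker (C.d m).dualMap = C.dualBoundaries m :=
    ((C.subsingleton_extMod_iff m).1 hm).antisymm (C.dualBoundaries_le_ker m)
  obtain ⟨e', he'⟩ := LinearMap.exists_linearEquiv_of_ker_le (e.toLinearMap ∘ₗ C.d n)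
    (C.d m).dualMap (by rw [LinearMap.range_comp, he]; rfl)
    (by rw [LinearEquiv.ker_comp, C.exact]; exact C.minimal _)
    (by rw [hker]; exact C.dualBoundaries_le_smul_top m)
  refine ⟨e', ?_, fun x => (he' x).symm⟩
  rw [← hker, ← C.exact]
  ext f
  obtain ⟨x, rfl⟩ := e'.surjective f
  rw [LinearMap.mem_ker, he' x]
  simp

theorem selfDual_of_isTotallySelfDual [IsNoetherianRing R] [Nontrivial M] (C : MinFreeRes R M)
    (hfin : ∃ r : ℕ, ∀ n, r < n → Subsingleton (C.F n)) (h : IsTotallySelfDual R M) :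
    C.SelfDual := by
  obtain ⟨r, hr, hn⟩ := C.exists_length hfin
  obtain ⟨-, ⟨eM⟩, hsub⟩ := h
  have hg : mgrade R M = r := by
    by_contra hne
    exact not_subsingleton_iff_nontrivial.2 (C.nontrivial_extMod_of_length hr hn)
      (hsub r (Ne.symm hne))
  rw [hg] at eM hsub
  let E (n m : ℕ) : Type := {e : C.F n ≃ₗ[R] Module.Dual R (C.F m) //
    (LinearMap.range (C.d n)).map e.toLinearMap = C.dualBoundaries m}
  have base : ∀ m, m + 0 = r → Nonempty (E 0 m) := by
    rintro m rfl
    have := C.free 0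
    have := C.fin 0
    have := C.free m
    have := C.fin m
    obtain ⟨p, hp, hk⟩ := C.exists_dual_linearMap_extMod (hr (m + 1) m.lt_succ_self)
    have hsurj : Function.Surjective (eM.toLinearMap ∘ₗ p) := eM.surjective.comp hp
    have hker : LinearMap.ker (eM.toLinearMap ∘ₗ p) = C.dualBoundaries m :=
      (LinearEquiv.ker_comp _ _).trans hk
    obtain ⟨e, he⟩ := LinearMap.exists_linearEquiv_of_ker_le C.aug (eM.toLinearMap ∘ₗ p)
      ((LinearMap.range_eq_top.2 C.aug_surj).trans
        (LinearMap.range_eq_top.2 hsurj).symm)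
      (by rw [C.exact_aug]; exact C.minimal 0)
      (by rw [hker]; exact C.dualBoundaries_le_smul_top m)
    refine ⟨e, ?_⟩
    rw [← hker, ← C.exact_aug]
    ext f
    obtain ⟨x, rfl⟩ := e.surjective f
    rw [LinearMap.mem_ker, he x]
    simp
  have step : ∀ n m, m + (n + 1) = r → ∀ e : E n (m + 1), ∃ e' : E (n + 1) m,
      ∀ x, e.1 (C.d n x) = (C.d m).dualMap (e'.1 x) := by
    intro n m hmn e
    obtain ⟨e', h₁, h₂⟩ := C.exists_linearEquiv_dual_succ n m (hsub m (by omega)) e.1 e.2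
    exact ⟨⟨e', h₁⟩, h₂⟩
  choose f hf using step
  let e (n : ℕ) : ∀ m, m + n = r → E n m :=
    Nat.rec (fun m hm => (base m hm).some)
      (fun n ih m hm => f n m hm (ih (m + 1) (by omega))) n
  exact ⟨r, hr, hn, fun m n hmn => (e n m hmn).1,
    fun q n hp hq => LinearMap.ext (hf n q hq (e n (q + 1) hp))⟩

end MinFreeRes

/-- Over a noetherian local ring, the minimal free resolution of a nonzero module `M` of
finite projective dimension is self-dual iff `M` is totally self-dual. -/
theorem stmt_11 (R : Type) [CommRing R] [IsLocalRing R] [IsNoetherianRing R]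
    (M : Type) [AddCommGroup M] [Module R M] [Module.Finite R M] [Nontrivial M]
    (C : MinFreeRes R M) (hfin : ∃ r : ℕ, ∀ n, r < n → Subsingleton (C.F n)) :
    C.SelfDual ↔ IsTotallySelfDual R M :=
  ⟨fun h => h.isTotallySelfDual, C.selfDual_of_isTotallySelfDual hfin⟩
end

section
/- A noetherian local ring (R, m, k) is regular if and only if the minimal free resolution of the residue field k is self-dual. -/
open CategoryTheory IsLocalRing

/-- A noetherian local ring is regular if its maximal ideal can be generated by
`dim R` elements. -/
def IsRegularLocal (R : Type) [CommRing R] [IsLocalRing R] : Prop :=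
  ∃ s : Finset R, Ideal.span (s : Set R) = maximalIdeal R ∧
    ((s.card : ℕ∞) : WithBot ℕ∞) = ringKrullDim R

theorem bijective_of_comp_eq_of_ker_le {R F S : Type*} [CommRing R] [IsLocalRing R]
    [AddCommGroup F] [Module R F] [Module.Finite R F] [AddCommGroup S] [Module R S]
    (p : F →ₗ[R] S) (hp : LinearMap.ker p ≤ maximalIdeal R • ⊤) (h : F →ₗ[R] F)
    (hh : p ∘ₗ h = p) : Function.Bijective h := by
  refine OrzechProperty.bijective_of_surjective_endomorphism h ?_
  rw [← LinearMap.range_eq_top, ← top_le_iff]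
  apply Submodule.le_of_le_smul_of_le_jacobson_bot Module.Finite.fg_top
    (IsLocalRing.jacobson_eq_maximalIdeal ⊥ bot_ne_top).ge
  intro x _
  rw [← sub_add_cancel x (h x), add_comm]
  refine Submodule.add_mem_sup ⟨x, rfl⟩ (hp ?_)
  have := LinearMap.congr_fun hh x
  simp only [LinearMap.coe_comp, Function.comp_apply] at this
  simp [this]

theorem exists_linearEquiv_of_minimal_covers {R F G S : Type*} [CommRing R] [IsLocalRing R]
    [AddCommGroup F] [Module R F] [AddCommGroup G] [Module R G] [AddCommGroup S] [Module R S]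
    [Module.Projective R F] [Module.Finite R F] [Module.Projective R G] [Module.Finite R G]
    (p : F →ₗ[R] S) (q : G →ₗ[R] S) (hp : Function.Surjective p) (hq : Function.Surjective q)
    (kp : LinearMap.ker p ≤ maximalIdeal R • ⊤) (kq : LinearMap.ker q ≤ maximalIdeal R • ⊤) :
    ∃ e : F ≃ₗ[R] G, ∀ x, q (e x) = p x := by
  obtain ⟨f, hf⟩ := Module.projective_lifting_property q p hq
  obtain ⟨g, hg⟩ := Module.projective_lifting_property p q hp
  have h1 := bijective_of_comp_eq_of_ker_le p kp (g ∘ₗ f) (by rw [← LinearMap.comp_assoc, hg, hf])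
  have h2 := bijective_of_comp_eq_of_ker_le q kq (f ∘ₗ g) (by rw [← LinearMap.comp_assoc, hf, hg])
  have hb : Function.Bijective f :=
    ⟨Function.Injective.of_comp (f := g) h1.1, Function.Surjective.of_comp (g := g) h2.2⟩
  exact ⟨LinearEquiv.ofBijective f hb, fun x => LinearMap.congr_fun hf x⟩

theorem exists_minimal_cover (R S : Type*) [CommRing R] [IsLocalRing R] [AddCommGroup S]
    [Module R S] [Module.Finite R S] :
    ∃ (n : ℕ) (p : (Fin n → R) →ₗ[R] S), Function.Surjective p ∧
      LinearMap.ker p ≤ maximalIdeal R • ⊤ := by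
  classical
  let b := Module.finBasis (ResidueField R) (TensorProduct R (ResidueField R) S)
  obtain ⟨v, hv⟩ := (TensorProduct.mk_surjective R S (ResidueField R)
    Ideal.Quotient.mk_surjective).comp_left b
  refine ⟨_, Fintype.linearCombination R v, ?_, fun a ha => ?_⟩
  · rw [← LinearMap.range_eq_top, Fintype.range_linearCombination]
    exact span_eq_top_of_tmul_eq_basis v b (congr_fun hv)
  have key : ∀ i, a i ∈ maximalIdeal R := by
    intro i
    rw [← residue_eq_zero_iff]
    have h := congr_arg (TensorProduct.mk R (ResidueField R) S 1) (LinearMap.mem_ker.1 ha)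
    rw [Fintype.linearCombination_apply, map_sum, map_zero] at h
    refine Fintype.linearIndependent_iff.1 b.linearIndependent (fun i => residue R (a i)) ?_ i
    rw [← h]
    refine Finset.sum_congr rfl fun i _ => ?_
    rw [map_smul, ← congr_fun hv i]
    exact algebraMap_smul (ResidueField R) (a i) _
  rw [← Finset.univ_sum_single a]
  refine Submodule.sum_mem _ fun i _ => ?_
  have : Pi.single i (a i) = a i • (Pi.single i 1 : Fin _ → R) := by
    rw [← Pi.single_smul]; simp
  rw [this]
  exact Submodule.smul_mem_smul (key i) trivial

theorem range_dualMap_le_smul_top {R F G : Type*} [CommRing R] (I : Ideal R)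
    [AddCommGroup F] [Module R F] [AddCommGroup G] [Module R G]
    [Module.Free R F] [Module.Finite R F] (f : F →ₗ[R] G)
    (hf : LinearMap.range f ≤ I • ⊤) : LinearMap.range f.dualMap ≤ I • ⊤ := by
  rintro _ ⟨φ, rfl⟩
  let b := Module.Free.chooseBasis R F
  rw [← b.sum_dual_apply_smul_coord (f.dualMap φ)]
  refine Submodule.sum_mem _ fun i _ => Submodule.smul_mem_smul ?_ trivial
  have h2 := Submodule.mem_map_of_mem (f := φ) (hf ⟨b i, rfl⟩)
  rw [Submodule.map_smul''] at h2
  exact Submodule.smul_le.2 (fun r hr n _ => Ideal.mul_mem_right n I hr) h2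

open scoped Pointwise in
theorem ext_quotSMulTop {R : Type} [CommRing R] (M N : ModuleCat.{0} R) (x : R) (n : ℕ)
    (reg : IsSMulRegular M x) (h0 : ∀ j ≠ n, Subsingleton (Abelian.Ext M N j))
    (e : Abelian.Ext M N n ≃ₗ[R] M) :
    (∀ j ≠ n + 1, Subsingleton (Abelian.Ext (ModuleCat.of R (QuotSMulTop x M)) N j)) ∧
      Nonempty (Abelian.Ext (ModuleCat.of R (QuotSMulTop x M)) N (n + 1) ≃ₗ[R]
        QuotSMulTop x M) := by
  let S := M.smulShortComplex x
  have hS : S.ShortExact := reg.smulShortComplex_shortExact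
  have hf : ∀ j (b : Abelian.Ext M N j),
      (Abelian.Ext.mk₀ S.f).comp b (zero_add j) = x • b := by
    intro j b
    have : (Abelian.Ext.mk₀ (x • 𝟙 M)).comp b (zero_add j) = x • b := by
      rw [Abelian.Ext.mk₀_smul, Abelian.Ext.smul_comp, Abelian.Ext.mk₀_id_comp]
    exact this
  have hreg : ∀ j (b : Abelian.Ext M N j), x • b = 0 → b = 0 := by
    intro j b hb
    by_cases hj : j = n
    · subst hj
      apply e.injective
      rw [map_zero]
      exact reg.right_eq_zero_of_smul (by rw [← map_smul, hb, map_zero])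
    · have := h0 j hj
      exact Subsingleton.elim _ _
  have hg : ∀ j (a : Abelian.Ext S.X₃ N j),
      (Abelian.Ext.mk₀ S.g).comp a (zero_add j) = 0 := by
    intro j a
    apply hreg
    have := hf j ((Abelian.Ext.mk₀ S.g).comp a (zero_add j))
    rw [Abelian.Ext.mk₀_comp_mk₀_assoc, S.zero, Abelian.Ext.mk₀_zero,
      Abelian.Ext.zero_comp] at this
    exact this.symm
  refine ⟨fun j hj => ⟨fun a a' => ?_⟩, ?_⟩
  · suffices ∀ a : Abelian.Ext S.X₃ N j, a = 0 from (this a).trans (this a').symm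
    intro a
    obtain _ | i := j
    · have : Epi S.g := hS.epi_g
      apply Abelian.Ext.precomp_mk₀_injective_of_epi N S.g
      simpa using hg 0 a
    · obtain ⟨b, rfl⟩ := Abelian.Ext.contravariant_sequence_exact₃ hS N a (hg _ a) (add_comm 1 i)
      have := h0 i (by lia)
      have : b = 0 := Subsingleton.elim (α := Abelian.Ext M N i) _ _
      rw [this, Abelian.Ext.comp_zero]
  · let δ : Abelian.Ext M N n →ₗ[R] Abelian.Ext S.X₃ N (n + 1) :=
      { toFun b := hS.extClass.comp b (add_comm 1 n)
        map_add' b c := Abelian.Ext.comp_add _ _ _ _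
        map_smul' r b := Abelian.Ext.comp_smul _ _ _ _ }
    have hδ : Function.Surjective δ := fun a =>
      Abelian.Ext.contravariant_sequence_exact₃ hS N a (hg _ a) (add_comm 1 n)
    have hk : LinearMap.ker δ = x • ⊤ := by
      ext b
      rw [LinearMap.mem_ker, Submodule.mem_smul_pointwise_iff_exists]
      constructor
      · intro hb
        obtain ⟨c, hc⟩ := Abelian.Ext.contravariant_sequence_exact₁ hS N b (add_comm 1 n) hb
        exact ⟨c, trivial, (hf n c).symm.trans hc⟩
      · rintro ⟨c, -, rfl⟩
        rw [← hf]
        exact hS.extClass_comp_assoc c (h := add_comm 1 n)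
    exact ⟨(δ.quotKerEquivOfSurjective hδ).symm ≪≫ₗ Submodule.quotEquivOfEq _ _ hk ≪≫ₗ
      QuotSMulTop.congr x e⟩

noncomputable def extLinearEquivOfIso {R : Type} [CommRing R] {X Y : ModuleCat.{0} R} (i : X ≅ Y)
    (N : ModuleCat.{0} R) (n : ℕ) : Abelian.Ext X N n ≃ₗ[R] Abelian.Ext Y N n where
  toFun a := (Abelian.Ext.mk₀ i.inv).comp a (zero_add n)
  invFun a := (Abelian.Ext.mk₀ i.hom).comp a (zero_add n)
  map_add' _ _ := Abelian.Ext.comp_add _ _ _ _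
  map_smul' _ _ := Abelian.Ext.comp_smul _ _ _ _
  left_inv a := by
    beta_reduce
    rw [Abelian.Ext.mk₀_comp_mk₀_assoc, i.hom_inv_id, Abelian.Ext.mk₀_id_comp]
  right_inv a := by
    beta_reduce
    rw [Abelian.Ext.mk₀_comp_mk₀_assoc, i.inv_hom_id, Abelian.Ext.mk₀_id_comp]

theorem ext_concentrated_of_linearEquiv {R : Type} [CommRing R] {X Y : ModuleCat.{0} R}
    (i : X ≃ₗ[R] Y) (N : ModuleCat.{0} R) (n : ℕ)
    (h : (∀ j ≠ n, Subsingleton (Abelian.Ext X N j)) ∧ Nonempty (Abelian.Ext X N n ≃ₗ[R] X)) :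
    (∀ j ≠ n, Subsingleton (Abelian.Ext Y N j)) ∧ Nonempty (Abelian.Ext Y N n ≃ₗ[R] Y) := by
  obtain ⟨h0, ⟨e⟩⟩ := h
  refine ⟨fun j hj => ?_, ⟨(extLinearEquivOfIso i.toModuleIso N n).symm ≪≫ₗ e ≪≫ₗ i⟩⟩
  have := h0 j hj
  exact (extLinearEquivOfIso i.toModuleIso N j).symm.toEquiv.subsingleton

open RingTheory.Sequence in
theorem ext_quotient_of_isWeaklyRegular {R : Type} [CommRing R] (N : ModuleCat.{0} R)
    (rs : List R) (M : ModuleCat.{0} R) (n : ℕ) (reg : IsWeaklyRegular M rs)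
    (h0 : ∀ j ≠ n, Subsingleton (Abelian.Ext M N j)) (e : Abelian.Ext M N n ≃ₗ[R] M) :
    (∀ j ≠ n + rs.length, Subsingleton (Abelian.Ext
      (ModuleCat.of R (M ⧸ Ideal.ofList rs • (⊤ : Submodule R M))) N j)) ∧
    Nonempty (Abelian.Ext (ModuleCat.of R (M ⧸ Ideal.ofList rs • (⊤ : Submodule R M))) N
      (n + rs.length) ≃ₗ[R] ModuleCat.of R (M ⧸ Ideal.ofList rs • (⊤ : Submodule R M))) := by
  induction rs generalizing M n with
  | nil =>
    have hbot : (Ideal.ofList ([] : List R)) • (⊤ : Submodule R M) = ⊥ := by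
      rw [Ideal.ofList_nil, Submodule.bot_smul]
    exact ext_concentrated_of_linearEquiv (Submodule.quotEquivOfEqBot _ hbot).symm N n ⟨h0, ⟨e⟩⟩
  | cons x rs ih =>
    rw [isWeaklyRegular_cons_iff] at reg
    obtain ⟨h1, ⟨e1⟩⟩ := ext_quotSMulTop M N x n reg.1 h0 e
    have := ih (ModuleCat.of R (QuotSMulTop x M)) (n + 1) reg.2 h1 e1
    rw [List.length_cons, show n + (rs.length + 1) = n + 1 + rs.length by ring]
    exact ext_concentrated_of_linearEquiv
      (Submodule.quotOfListConsSMulTopEquivQuotSMulTopInner M x rs).symm N _ this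

theorem exists_span_singleton_sup_eq_maximalIdeal {R : Type*} [CommRing R] [IsLocalRing R] {n : ℕ}
    (s : Fin (n + 1) → R) (hs : Ideal.span (Set.range s) = maximalIdeal R) {x : R}
    (hx : x ∈ maximalIdeal R) (hx2 : x ∉ maximalIdeal R ^ 2) :
    ∃ t : Fin n → R, Ideal.span {x} ⊔ Ideal.span (Set.range t) = maximalIdeal R := by
  have hsm : ∀ i, s i ∈ maximalIdeal R := fun i => hs ▸ Ideal.subset_span ⟨i, rfl⟩
  obtain ⟨a, ha⟩ := Ideal.mem_span_range_iff_exists_fun.1 (hs.symm ▸ hx)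
  have : ∃ i, IsUnit (a i) := by
    by_contra! h
    refine hx2 (ha ▸ Ideal.sum_mem _ fun i _ => ?_)
    rw [pow_two]
    exact Ideal.mul_mem_mul ((mem_maximalIdeal _).2 (h i)) (hsm i)
  obtain ⟨i, u, hu⟩ := this
  refine ⟨s ∘ i.succAbove, le_antisymm ?_ ?_⟩
  · refine sup_le ((Ideal.span_singleton_le_iff_mem _).2 hx) (Ideal.span_le.2 ?_)
    rintro _ ⟨j, rfl⟩
    exact hsm _
  · rw [← hs, Ideal.span_le]
    have hj : ∀ j, s (i.succAbove j) ∈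
        Ideal.span {x} ⊔ Ideal.span (Set.range (s ∘ i.succAbove)) := fun j =>
      Ideal.mem_sup_right (Ideal.subset_span ⟨j, rfl⟩)
    rintro _ ⟨j, rfl⟩
    obtain rfl | ⟨k, rfl⟩ := Fin.eq_self_or_eq_succAbove i j
    · rw [Fin.sum_univ_succAbove _ j] at ha
      have : s j = ↑u⁻¹ * (x - ∑ k, a (j.succAbove k) * s (j.succAbove k)) := by
        rw [← ha, add_sub_cancel_right, ← hu, Units.inv_mul_cancel_left]
      rw [SetLike.mem_coe, this]
      exact Ideal.mul_mem_left _ _ (sub_mem (Ideal.mem_sup_left (Ideal.mem_span_singleton_self x))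
        (Ideal.sum_mem _ fun j _ => Ideal.mul_mem_left _ _ (hj j)))
    · exact hj k

theorem ringKrullDim_le_of_span_range_eq {R : Type*} [CommRing R] [IsLocalRing R]
    [IsNoetherianRing R] {n : ℕ} (s : Fin n → R)
    (hs : Ideal.span (Set.range s) = maximalIdeal R) : ringKrullDim R ≤ n := by
  refine (ringKrullDim_le_spanFinrank_maximalIdeal R).trans ?_
  rw [← hs]
  have h1 := Submodule.spanFinrank_span_le_ncard_of_finite (R := R) (Set.finite_range s)
  have h2 : (Set.range s).ncard ≤ n := by
    rw [← Set.image_univ]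
    exact (Set.ncard_image_le Set.finite_univ).trans (by simp [Set.ncard_univ])
  exact_mod_cast h1.trans h2

theorem exists_mem_maximalIdeal_notMem_sq {R : Type*} [CommRing R] [IsLocalRing R]
    [IsNoetherianRing R] (hm : maximalIdeal R ≠ ⊥) (S : Set (Ideal R)) (hS : S.Finite)
    (hp : ∀ p ∈ S, p.IsPrime ∧ ¬ maximalIdeal R ≤ p) :
    ∃ x ∈ maximalIdeal R, x ∉ maximalIdeal R ^ 2 ∧ ∀ p ∈ S, x ∉ p := by
  have key := (Ideal.subset_union_prime_finite (R := R) (ι := Ideal R)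
    (s := insert (maximalIdeal R ^ 2) S) (hS.insert _) (f := id) (maximalIdeal R ^ 2)
    (maximalIdeal R ^ 2)
    (fun i hi h _ => (hp i (hi.resolve_left h)).1) (I := maximalIdeal R)).not.2 (by
      rintro ⟨p, rfl | hpS, hle⟩
      · refine hm (Submodule.eq_bot_of_le_smul_of_le_jacobson_bot (maximalIdeal R) _
          (IsNoetherian.noetherian _) ?_ (IsLocalRing.maximalIdeal_le_jacobson _))
        simpa [pow_two] using hle
      · exact (hp p hpS).2 hle)
  rw [Set.not_subset] at key
  obtain ⟨x, hx, hx'⟩ := key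
  simp only [Set.mem_iUnion, not_exists] at hx'
  exact ⟨x, hx, hx' _ (Set.mem_insert _ _), fun p hpS => hx' p (Set.mem_insert_of_mem _ hpS)⟩

theorem isLocalRing_quotient_span_singleton {R : Type*} [CommRing R] [IsLocalRing R] {x : R}
    (hx : x ∈ maximalIdeal R) : IsLocalRing (R ⧸ Ideal.span {x}) := by
  have : Nontrivial (R ⧸ Ideal.span {x}) := Ideal.Quotient.nontrivial_iff.2 fun h =>
    Ideal.IsPrime.ne_top' (top_le_iff.1 (h ▸ (Ideal.span_singleton_le_iff_mem _).2 hx))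
  exact IsLocalRing.of_surjective' (Ideal.Quotient.mk _) Ideal.Quotient.mk_surjective

open RingTheory.Sequence Pointwise in
theorem exists_isWeaklyRegular_ofList_eq_maximalIdeal (n : ℕ) :
    ∀ (R : Type) [CommRing R] [IsLocalRing R] [IsNoetherianRing R] (s : Fin n → R),
      Ideal.span (Set.range s) = maximalIdeal R → (n : WithBot ℕ∞) ≤ ringKrullDim R →
      IsDomain R ∧ ∃ rs : List R, rs.length = n ∧ Ideal.ofList rs = maximalIdeal R ∧
        IsWeaklyRegular R rs := by
  induction n with
  | zero =>
    intro R _ _ _ s hs _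
    have hm : maximalIdeal R = ⊥ := by
      rw [← hs, Set.range_eq_empty, Ideal.span_empty]
    exact ⟨((isField_iff_maximalIdeal_eq).2 hm).isDomain, [], rfl, by simp [hm], .nil R R⟩
  | succ n ih =>
    intro R _ _ _ s hs hd
    have hdim : ringKrullDim R ≠ 0 := by
      intro h
      rw [h] at hd
      exact absurd hd (by norm_cast)
    have hm : maximalIdeal R ≠ ⊥ := by
      intro h
      have := ringKrullDim_le_of_span_range_eq (R := R) (n := 0) ![]
        (by rw [h, Set.range_eq_empty, Ideal.span_empty])
      exact absurd (hd.trans this) (by norm_cast; simp)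
    have hmin : maximalIdeal R ∉ minimalPrimes R := by
      intro h
      have h0 : (maximalIdeal R).height = 0 := by
        rw [Ideal.height_eq_zero_iff]
        exact h
      rw [← IsLocalRing.maximalIdeal_height_eq_ringKrullDim, h0] at hdim
      exact hdim rfl
    obtain ⟨x, hx, hx2, hxp⟩ := exists_mem_maximalIdeal_notMem_sq hm (minimalPrimes R)
      (minimalPrimes.finite_of_isNoetherianRing R) (fun p hp => ⟨hp.1.1, fun hle => by
        have := hp.1.1
        rw [← le_antisymm hle (le_maximalIdeal this.ne_top)] at hp
        exact hmin hp⟩)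
    obtain ⟨t, ht⟩ := exists_span_singleton_sup_eq_maximalIdeal s hs hx hx2
    have hloc := isLocalRing_quotient_span_singleton hx
    have hmap := map_maximalIdeal_of_surjective (Ideal.Quotient.mk (Ideal.span {x}))
      Ideal.Quotient.mk_surjective
    obtain ⟨hdom, rs', hlen, hrs', hreg⟩ := ih (R ⧸ Ideal.span {x})
      (Ideal.Quotient.mk (Ideal.span {x}) ∘ t) (by
        rw [← hmap, ← ht, Ideal.map_sup, Ideal.map_span, Ideal.map_span, Set.range_comp]
        simp) (by
        have := ringKrullDim_le_ringKrullDim_quotient_add_card (R := R) {x} (by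
          rw [IsLocalRing.ringJacobson_eq_maximalIdeal]; simpa using hx)
        have h := hd.trans this
        simp only [Finset.card_singleton] at h
        rw [Nat.cast_add, Finset.coe_singleton] at h
        exact (ENat.WithBot.add_le_add_natCast_right_iff).1 h)
    have hprime : (Ideal.span {x}).IsPrime := Ideal.Quotient.isDomain_iff_prime _ |>.1 hdom
    obtain ⟨P, hP, hPx⟩ := Ideal.exists_minimalPrimes_le (bot_le : ⊥ ≤ Ideal.span {x})
    have hPp : P.IsPrime := hP.1.1
    have hP0 : P = ⊥ := by
      refine Submodule.eq_bot_of_le_smul_of_le_jacobson_bot (maximalIdeal R) _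
        (IsNoetherian.noetherian _) (fun y hy => ?_) (IsLocalRing.maximalIdeal_le_jacobson _)
      obtain ⟨z, rfl⟩ := Ideal.mem_span_singleton'.1 (hPx hy)
      have hz : z ∈ P := (hPp.mem_or_mem hy).resolve_right (hxp P hP)
      rw [mul_comm]
      exact Ideal.mul_mem_mul hx hz
    subst hP0
    have hdomR : IsDomain R := IsDomain.of_bot_isPrime R
    have hx0 : x ≠ 0 := fun h => hxp ⊥ hP (by simp [h])
    refine ⟨hdomR, ?_⟩
    obtain ⟨rs, rfl⟩ := (List.map_surjective_iff.2
      (Ideal.Quotient.mk_surjective (I := Ideal.span {x}))) rs'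
    refine ⟨x :: rs, by simpa using hlen, ?_, ?_⟩
    · rw [Ideal.ofList_cons]
      rw [← Ideal.map_ofList] at hrs'
      have := IsLocalHom.of_surjective (Ideal.Quotient.mk (Ideal.span {x})) Ideal.Quotient.mk_surjective
      rw [← maximalIdeal_comap (Ideal.Quotient.mk (Ideal.span {x})), ← hrs',
        Ideal.comap_map_of_surjective' _ Ideal.Quotient.mk_surjective, Ideal.mk_ker, sup_comm]
    · refine IsWeaklyRegular.cons ?_ ?_
      · exact (IsRegular.of_ne_zero hx0).left.isSMulRegular
      · have h : x • (⊤ : Submodule R R) = Ideal.span {x} := by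
          rw [← Submodule.ideal_span_singleton_smul]; simp
        exact ((Submodule.quotEquivOfEq _ _ h).isWeaklyRegular_congr rs).2
          ((isWeaklyRegular_map_algebraMap_iff (R := R) (S := R ⧸ Ideal.span {x}) (M := R ⧸ Ideal.span {x}) rs).1 hreg)

theorem subsingleton_ext_of_projective {R : Type} [CommRing R] (F N : ModuleCat.{0} R)
    [Projective F] {j : ℕ} (hj : j ≠ 0) : Subsingleton (Abelian.Ext F N j) := by
  obtain ⟨i, rfl⟩ := Nat.exists_eq_succ_of_ne_zero hj
  exact Abelian.Ext.subsingleton_of_projective F N i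

theorem exists_ext_residueField_of_isRegularLocal {R : Type} [CommRing R] [IsLocalRing R]
    [IsNoetherianRing R] (h : IsRegularLocal R) :
    ∃ d, HasProjectiveDimensionLT (ModuleCat.of R (ResidueField R)) (d + 1) ∧
      (∀ j ≠ d, Subsingleton
        (Abelian.Ext (ModuleCat.of R (ResidueField R)) (ModuleCat.of R R) j)) ∧
      Nonempty (Abelian.Ext (ModuleCat.of R (ResidueField R)) (ModuleCat.of R R) d ≃ₗ[R]
        ResidueField R) := by
  obtain ⟨s, hs, hcard⟩ := h
  obtain ⟨hdom, rs, hlen, hofList, hreg⟩ := exists_isWeaklyRegular_ofList_eq_maximalIdeal s.card R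
    (fun i => (s.equivFin.symm i : R)) (by
      rw [← hs]
      congr 1
      ext x
      constructor
      · rintro ⟨i, rfl⟩
        exact (s.equivFin.symm i).2
      · exact fun hx => ⟨s.equivFin ⟨x, hx⟩, by simp⟩) hcard.le
  have hI : Ideal.ofList rs • (⊤ : Submodule R R) = maximalIdeal R := by
    rw [hofList]; simp
  let i : (R ⧸ Ideal.ofList rs • (⊤ : Submodule R R)) ≃ₗ[R] ResidueField R :=
    Submodule.quotEquivOfEq _ _ hI
  have key := ext_quotient_of_isWeaklyRegular (ModuleCat.of R R) rs (ModuleCat.of R R) 0 hreg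
    (fun j hj => subsingleton_ext_of_projective _ _ hj)
    (Abelian.Ext.linearEquiv₀ ≪≫ₗ ModuleCat.homLinearEquiv ≪≫ₗ LinearMap.ringLmapEquivSelf R R R)
  have key := ext_concentrated_of_linearEquiv (Y := ModuleCat.of R (ResidueField R)) i _ _ key
  rw [zero_add] at key
  refine ⟨rs.length, ?_, key⟩
  have hproj : HasProjectiveDimensionLE (ModuleCat.of R R) 0 :=
    projective_iff_hasProjectiveDimensionLT_one |>.1 inferInstance
  have := ModuleCat.projectiveDimension_quotient_eq_add_length_of_isWeaklyRegular
    (ModuleCat.of R R) rs hreg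
    (fun r hr => hofList ▸ Ideal.subset_span hr)
  have i' : ModuleCat.of R (R ⧸ Ideal.ofList rs • (⊤ : Submodule R R)) ≅
    ModuleCat.of R (ResidueField R) := i.toModuleIso
  rw [← projectiveDimension_eq_of_iso i'.symm] at this
  change HasProjectiveDimensionLE _ _
  rw [← projectiveDimension_le_iff, this]
  have h0 := (projectiveDimension_le_iff _ _).2 hproj
  calc _ ≤ ((0 : ℕ) : WithBot ℕ∞) + rs.length := by gcongr
    _ = _ := by simp

theorem exists_linearEquiv_comp_eq_of_map_range_eq {R F₁ F₀ G₁ G₀ : Type*} [CommRing R]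
    [IsLocalRing R] [AddCommGroup F₁] [Module R F₁] [AddCommGroup G₁] [Module R G₁]
    [AddCommGroup F₀] [Module R F₀] [AddCommGroup G₀] [Module R G₀]
    [Module.Projective R F₁] [Module.Finite R F₁] [Module.Projective R G₁] [Module.Finite R G₁]
    (d : F₁ →ₗ[R] F₀) (δ : G₁ →ₗ[R] G₀) (g : F₀ ≃ₗ[R] G₀)
    (hg : (LinearMap.range d).map g.toLinearMap = LinearMap.range δ)
    (hd : LinearMap.ker d ≤ maximalIdeal R • ⊤) (hδ : LinearMap.ker δ ≤ maximalIdeal R • ⊤) :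
    ∃ e : F₁ ≃ₗ[R] G₁, g.toLinearMap ∘ₗ d = δ ∘ₗ e.toLinearMap := by
  let p : F₁ →ₗ[R] LinearMap.range δ := (g.toLinearMap ∘ₗ d).codRestrict _ fun x => by
    rw [← hg]
    exact Submodule.mem_map_of_mem (LinearMap.mem_range_self _ x)
  have hp : Function.Surjective p := by
    rintro ⟨y, hy⟩
    rw [← hg, ← LinearMap.range_comp, LinearMap.mem_range] at hy
    exact hy.imp fun x hx => Subtype.ext hx
  have hkp : LinearMap.ker p ≤ maximalIdeal R • ⊤ := by
    rwa [LinearMap.ker_codRestrict, LinearEquiv.ker_comp]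
  obtain ⟨e, he⟩ := exists_linearEquiv_of_minimal_covers p δ.rangeRestrict hp
    (LinearMap.surjective_rangeRestrict _) hkp (by rwa [LinearMap.ker_rangeRestrict])
  refine ⟨e, LinearMap.ext fun x => ?_⟩
  have := congrArg Subtype.val (he x)
  exact this.symm

namespace MinFreeRes

variable {R : Type} [CommRing R] [IsLocalRing R] {M : Type} [AddCommGroup M] [Module R M]

theorem exists_equiv_dual_succ (C : MinFreeRes R M) {n q : ℕ}
    (g : C.F n ≃ₗ[R] Module.Dual R (C.F (q + 1)))
    (hg : (LinearMap.range (C.d n)).map g.toLinearMap = LinearMap.range (C.d q).dualMap)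
    (hq : LinearMap.ker (C.d q).dualMap ≤
      maximalIdeal R • (⊤ : Submodule R (Module.Dual R (C.F q)))) :
    ∃ e : C.F (n + 1) ≃ₗ[R] Module.Dual R (C.F q),
      g.toLinearMap ∘ₗ C.d n = (C.d q).dualMap ∘ₗ e.toLinearMap := by
  have := C.free
  have := C.fin
  exact exists_linearEquiv_comp_eq_of_map_range_eq (C.d n) (C.d q).dualMap g hg
    (C.exact n ▸ C.minimal (n + 1)) hq

theorem exists_equiv_dual (C : MinFreeRes R M) (r : ℕ)
    (h0 : 1 ≤ r → LinearMap.ker (C.d 0).dualMap = ⊥)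
    (h1 : ∀ q, q + 1 < r → LinearMap.ker (C.d (q + 1)).dualMap = LinearMap.range (C.d q).dualMap)
    (π : Module.Dual R (C.F r) →ₗ[R] M) (hπ : Function.Surjective π)
    (hπm : LinearMap.ker π ≤ maximalIdeal R • ⊤)
    (hπk : ∀ q (hq : q + 1 = r), LinearMap.ker (hq ▸ π : Module.Dual R (C.F (q + 1)) →ₗ[R] M) =
      LinearMap.range (C.d q).dualMap) :
    ∃ e : ∀ ⦃m n : ℕ⦄, m + n = r → (C.F n ≃ₗ[R] Module.Dual R (C.F m)),
      ∀ (q n : ℕ) (hp : (q + 1) + n = r) (hq : q + (n + 1) = r),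
        (e hp).toLinearMap ∘ₗ C.d n = (C.d q).dualMap ∘ₗ (e hq).toLinearMap := by
  have := C.free
  have := C.fin
  let T (n : ℕ) := ∀ m, m + n = r → (C.F n ≃ₗ[R] Module.Dual R (C.F m))
  let Good (n : ℕ) (g : T n) : Prop := ∀ q (hq : q + 1 + n = r),
    (LinearMap.range (C.d n)).map (g (q + 1) hq).toLinearMap = LinearMap.range (C.d q).dualMap
  have base : ∃ g : T 0, Good 0 g := by
    obtain ⟨e, he⟩ := exists_linearEquiv_of_minimal_covers C.aug π C.aug_surj hπ
      (C.exact_aug ▸ C.minimal 0) hπm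
    refine ⟨fun m hm => (show r = m by lia) ▸ e, fun q hq => ?_⟩
    obtain rfl : q + 1 = r := hq
    rw [← hπk q rfl, ← C.exact_aug]
    change (LinearMap.ker C.aug).map e.toLinearMap = LinearMap.ker π
    ext y
    constructor
    · rintro ⟨x, hx, rfl⟩
      exact (he x).trans hx
    · intro hy
      refine ⟨e.symm y, ?_, e.apply_symm_apply y⟩
      rw [SetLike.mem_coe, LinearMap.mem_ker, ← he, e.apply_symm_apply]
      exact hy
  have step : ∀ n (g : {g : T n // Good n g}), ∃ g' : {g : T (n + 1) // Good (n + 1) g},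
      ∀ q (hp : (q + 1) + n = r) (hq : q + (n + 1) = r),
        (g.1 _ hp).toLinearMap ∘ₗ C.d n = (C.d q).dualMap ∘ₗ (g'.1 _ hq).toLinearMap := by
    rintro n ⟨g, hg⟩
    by_cases h : ∃ q, q + (n + 1) = r
    · obtain ⟨q, hq⟩ := h
      have hq' : q + 1 + n = r := by lia
      obtain ⟨e, he⟩ := C.exists_equiv_dual_succ (g (q + 1) hq') (hg q hq') (by
        obtain _ | q := q
        · rw [h0 (by lia)]; exact bot_le
        · rw [h1 q (by lia)]
          exact range_dualMap_le_smul_top _ _ (C.minimal q))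
      refine ⟨⟨fun m hm => (show q = m by lia) ▸ e, fun q' h' => ?_⟩, fun q' h' h'' => ?_⟩
      · obtain rfl : q' + 1 = q := by lia
        rw [← h1 q' (by lia), ← C.exact]
        change (LinearMap.ker (C.d n)).map e.toLinearMap = _
        have he' (x) : g (q' + 1 + 1) hq' (C.d n x) = (C.d (q' + 1)).dualMap (e x) :=
          LinearMap.congr_fun he x
        ext y
        constructor
        · rintro ⟨x, hx, rfl⟩
          refine (he' x).symm.trans ?_
          rw [LinearMap.mem_ker.1 hx, map_zero]
        · intro hy
          refine ⟨e.symm y, ?_, e.apply_symm_apply y⟩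
          rw [SetLike.mem_coe, LinearMap.mem_ker, ← (g (q' + 1 + 1) hq').map_eq_zero_iff, he',
            e.apply_symm_apply]
          exact hy
      · obtain rfl : q' = q := by lia
        exact he
    · exact ⟨⟨fun m hm => absurd ⟨m, hm⟩ h, fun q hq => absurd ⟨q + 1, hq⟩ h⟩,
        fun q hp hq => absurd ⟨q, hq⟩ h⟩
  choose s hs using step
  obtain ⟨g0, hg0⟩ := base
  let e (n : ℕ) : {g : T n // Good n g} := Nat.rec ⟨g0, hg0⟩ s n
  exact ⟨fun m n h => (e n).1 m h, fun q n hp hq => hs n (e n) q hp hq⟩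

end MinFreeRes

theorem ext_linearEquiv_of_shortExact {R : Type} [CommRing R] {S : ShortComplex (ModuleCat.{0} R)}
    (hS : S.ShortExact) [Projective S.X₂] (N : ModuleCat.{0} R) {j : ℕ} (hj : j ≠ 0) :
    Nonempty (Abelian.Ext S.X₁ N j ≃ₗ[R] Abelian.Ext S.X₃ N (j + 1)) := by
  have := subsingleton_ext_of_projective S.X₂ N hj
  have := subsingleton_ext_of_projective S.X₂ N j.succ_ne_zero
  let δ : Abelian.Ext S.X₁ N j →ₗ[R] Abelian.Ext S.X₃ N (j + 1) :=
    { toFun b := hS.extClass.comp b (add_comm 1 j)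
      map_add' b c := Abelian.Ext.comp_add _ _ _ _
      map_smul' r b := Abelian.Ext.comp_smul _ _ _ _ }
  refine ⟨LinearEquiv.ofBijective δ ⟨?_, fun a => ?_⟩⟩
  · rw [injective_iff_map_eq_zero]
    intro b hb
    obtain ⟨c, rfl⟩ := Abelian.Ext.contravariant_sequence_exact₁ hS N b (add_comm 1 j) hb
    rw [Subsingleton.elim c 0, Abelian.Ext.comp_zero]
  · exact Abelian.Ext.contravariant_sequence_exact₃ hS N a (Subsingleton.elim _ _) (add_comm 1 j)

theorem exists_hom_linearMap_ext_one_of_shortExact {R : Type} [CommRing R]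
    {S : ShortComplex (ModuleCat.{0} R)} (hS : S.ShortExact) [Projective S.X₂]
    (N : ModuleCat.{0} R) :
    ∃ δ : (S.X₁ →ₗ[R] N) →ₗ[R] Abelian.Ext S.X₃ N 1, Function.Surjective δ ∧
      ∀ φ, δ φ = 0 ↔ ∃ ψ : S.X₂ →ₗ[R] N, ψ ∘ₗ S.f.hom = φ := by
  have := subsingleton_ext_of_projective S.X₂ N one_ne_zero
  let δ : Abelian.Ext S.X₁ N 0 →ₗ[R] Abelian.Ext S.X₃ N 1 :=
    { toFun b := hS.extClass.comp b (add_zero 1)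
      map_add' b c := Abelian.Ext.comp_add _ _ _ _
      map_smul' r b := Abelian.Ext.comp_smul _ _ _ _ }
  let E : Abelian.Ext S.X₁ N 0 ≃ₗ[R] (S.X₁ →ₗ[R] N) :=
    Abelian.Ext.linearEquiv₀ ≪≫ₗ ModuleCat.homLinearEquiv
  have hE (φ : S.X₁ →ₗ[R] N) : E.symm φ = Abelian.Ext.mk₀ (ModuleCat.ofHom φ) := rfl
  refine ⟨δ ∘ₗ E.symm.toLinearMap, ?_, fun φ => ⟨fun h => ?_, ?_⟩⟩
  · refine Function.Surjective.comp (g := δ) (fun a => ?_) E.symm.surjective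
    exact Abelian.Ext.contravariant_sequence_exact₃ hS N a (Subsingleton.elim _ _) (add_zero 1)
  · obtain ⟨c, hc⟩ := Abelian.Ext.contravariant_sequence_exact₁ hS N (E.symm φ) (add_zero 1) h
    obtain ⟨ψ, rfl⟩ := (Abelian.Ext.mk₀_bijective _ _).2 c
    rw [Abelian.Ext.mk₀_comp_mk₀, hE] at hc
    have := (Abelian.Ext.mk₀_bijective _ _).1 hc
    exact ⟨ψ.hom, congrArg ModuleCat.Hom.hom this⟩
  · rintro ⟨ψ, rfl⟩
    have : E.symm (ψ ∘ₗ S.f.hom) =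
        (Abelian.Ext.mk₀ S.f).comp (Abelian.Ext.mk₀ (ModuleCat.ofHom ψ)) (zero_add 0) := by
      rw [Abelian.Ext.mk₀_comp_mk₀]; rfl
    change δ (E.symm (ψ ∘ₗ S.f.hom)) = 0
    rw [this]
    exact hS.extClass_comp_assoc _ (h := add_zero 1)

namespace MinFreeRes

variable {R : Type} [CommRing R] [IsLocalRing R] {M : Type} [AddCommGroup M] [Module R M]

noncomputable def syzIncl (C : MinFreeRes R M) (n : ℕ) : C.Syz (n + 1) →ₗ[R] C.F n :=
  (LinearMap.range (C.d n)).subtype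

noncomputable def syzProj (C : MinFreeRes R M) : ∀ n, C.F n →ₗ[R] C.Syz n
  | 0 => C.aug
  | n + 1 => (C.d n).rangeRestrict

theorem syzProj_surjective (C : MinFreeRes R M) : ∀ n, Function.Surjective (C.syzProj n)
  | 0 => C.aug_surj
  | n + 1 => (C.d n).surjective_rangeRestrict

theorem ker_syzProj (C : MinFreeRes R M) : ∀ n,
    LinearMap.ker (C.syzProj n) = LinearMap.range (C.d n)
  | 0 => C.exact_aug
  | n + 1 => ((C.d n).ker_rangeRestrict).trans (C.exact n)

theorem range_syzIncl (C : MinFreeRes R M) (n : ℕ) :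
    LinearMap.range (C.syzIncl n) = LinearMap.range (C.d n) :=
  Submodule.range_subtype _

noncomputable def syzComplex (C : MinFreeRes R M) (n : ℕ) : ShortComplex (ModuleCat.{0} R) where
  X₁ := C.Syz (n + 1)
  X₂ := C.F n
  X₃ := C.Syz n
  f := ModuleCat.ofHom (C.syzIncl n)
  g := ModuleCat.ofHom (C.syzProj n)
  zero := by
    ext x
    have : C.syzIncl n x ∈ LinearMap.ker (C.syzProj n) := by
      rw [ker_syzProj, ← range_syzIncl]
      exact ⟨x, rfl⟩
    exact this

theorem syzComplex_shortExact (C : MinFreeRes R M) (n : ℕ) : (C.syzComplex n).ShortExact :=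
  ModuleCat.shortComplex_shortExact _
    (LinearMap.exact_iff.2 ((C.ker_syzProj n).trans (C.range_syzIncl n).symm))
    (Submodule.injective_subtype _) (C.syzProj_surjective n)

instance (C : MinFreeRes R M) (n : ℕ) : Projective (C.syzComplex n).X₂ := by
  have := C.free n
  exact (IsProjective.iff_projective (C.F n)).1 inferInstance

theorem ext_syz_linearEquiv (C : MinFreeRes R M) (N : ModuleCat.{0} R) (n j : ℕ) :
    Nonempty (Abelian.Ext (C.Syz n) N (j + 1) ≃ₗ[R]
      Abelian.Ext (ModuleCat.of R M) N (n + j + 1)) := by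
  induction n generalizing j with
  | zero => rw [zero_add]; exact ⟨LinearEquiv.refl _ _⟩
  | succ n ih =>
    obtain ⟨e⟩ := ext_linearEquiv_of_shortExact (C.syzComplex_shortExact n) N j.succ_ne_zero
    obtain ⟨e'⟩ := ih (j + 1)
    rw [show n + 1 + j + 1 = n + (j + 1) + 1 by ring]
    exact ⟨e ≪≫ₗ e'⟩

theorem exists_hom_syz_linearMap_ext (C : MinFreeRes R M) (N : ModuleCat.{0} R) (n : ℕ) :
    ∃ δ : (C.Syz (n + 1) →ₗ[R] N) →ₗ[R] Abelian.Ext (ModuleCat.of R M) N (n + 1),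
      Function.Surjective δ ∧ ∀ φ, δ φ = 0 ↔ ∃ ψ : C.F n →ₗ[R] N, ψ ∘ₗ C.syzIncl n = φ := by
  obtain ⟨δ, h1, h2⟩ := exists_hom_linearMap_ext_one_of_shortExact (C.syzComplex_shortExact n) N
  obtain ⟨e⟩ := C.ext_syz_linearEquiv N n 0
  exact ⟨e.toLinearMap ∘ₗ δ, e.surjective.comp h1, fun φ => (e.map_eq_zero_iff (x := δ φ)).trans
    (h2 φ)⟩

end MinFreeRes

theorem exists_comp_eq_of_ker_le {R M N P : Type*} [CommRing R] [AddCommGroup M] [Module R M]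
    [AddCommGroup N] [Module R N] [AddCommGroup P] [Module R P] (p : M →ₗ[R] N)
    (hp : Function.Surjective p) (φ : M →ₗ[R] P) (h : LinearMap.ker p ≤ LinearMap.ker φ) :
    ∃ ψ : N →ₗ[R] P, ψ ∘ₗ p = φ := by
  refine ⟨(LinearMap.ker p).liftQ φ h ∘ₗ (p.quotKerEquivOfSurjective hp).symm.toLinearMap, ?_⟩
  ext x
  have : (p.quotKerEquivOfSurjective hp).symm (p x) = Submodule.Quotient.mk x := by
    rw [LinearEquiv.symm_apply_eq]; rfl
  simp [this]

namespace MinFreeRes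

variable {R : Type} [CommRing R] [IsLocalRing R] {M : Type} [AddCommGroup M] [Module R M]

theorem d_d (C : MinFreeRes R M) (n : ℕ) (x : C.F (n + 2)) : C.d n (C.d (n + 1) x) = 0 := by
  rw [← LinearMap.mem_ker, C.exact]
  exact ⟨x, rfl⟩

theorem subsingleton_F_succ (C : MinFreeRes R M) (n : ℕ) (h : C.d n = 0) :
    Subsingleton (C.F (n + 1)) := by
  have := C.fin (n + 1)
  have hle : (⊤ : Submodule R (C.F (n + 1))) ≤ maximalIdeal R • ⊤ := by
    refine le_trans ?_ (C.minimal (n + 1))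
    rw [← C.exact, h, LinearMap.ker_zero]
  have := Submodule.eq_bot_of_le_smul_of_le_jacobson_bot (maximalIdeal R) _
    Module.Finite.fg_top hle (IsLocalRing.maximalIdeal_le_jacobson _)
  exact (Submodule.subsingleton_iff R).1 (subsingleton_of_bot_eq_top this.symm)

theorem subsingleton_F_of_lt (C : MinFreeRes R M) {r : ℕ} (h : C.d r = 0) :
    ∀ n, r < n → Subsingleton (C.F n) := by
  intro n hn
  obtain ⟨k, rfl⟩ := Nat.exists_eq_add_of_lt hn
  clear hn
  induction k with
  | zero => exact C.subsingleton_F_succ r h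
  | succ k ih => exact C.subsingleton_F_succ _ (LinearMap.ext fun x => Subsingleton.elim _ _)

theorem hasProjectiveDimensionLT_syz (C : MinFreeRes R M) {r : ℕ}
    (h : HasProjectiveDimensionLT (ModuleCat.of R M) (r + 1)) :
    ∀ n j, n + j = r → HasProjectiveDimensionLT (C.Syz n) (j + 1) := by
  intro n
  induction n with
  | zero => rintro j rfl; rwa [zero_add] at h
  | succ n ih =>
    intro j hj
    exact ((C.syzComplex_shortExact n).hasProjectiveDimensionLT_X₃_iff j inferInstance).1
      (ih (j + 1) (by lia))

theorem syzProj_injective (C : MinFreeRes R M) {r : ℕ}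
    (h : HasProjectiveDimensionLT (ModuleCat.of R M) (r + 1)) :
    Function.Injective (C.syzProj r) := by
  have := C.free r
  have := C.fin r
  have hp : Projective (C.Syz r) :=
    projective_iff_hasProjectiveDimensionLT_one.2 (C.hasProjectiveDimensionLT_syz h r 0 rfl)
  have := (IsProjective.iff_projective (C.Syz r)).2 hp
  have := Module.Finite.of_surjective _ (C.syzProj_surjective r)
  obtain ⟨e, he⟩ := exists_linearEquiv_of_minimal_covers (C.syzProj r) (LinearMap.id)
    (C.syzProj_surjective r) Function.surjective_id (C.ker_syzProj r ▸ C.minimal r) (by simp)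
  intro x y hxy
  apply e.injective
  exact (he x).trans (hxy.trans (he y).symm)

theorem ker_dualMap_zero (C : MinFreeRes R M)
    (h : Subsingleton (Abelian.Ext (ModuleCat.of R M) (ModuleCat.of R R) 0)) :
    LinearMap.ker (C.d 0).dualMap = ⊥ := by
  rw [LinearMap.ker_eq_bot']
  intro φ hφ
  obtain ⟨ψ, rfl⟩ : ∃ ψ : M →ₗ[R] R, ψ ∘ₗ C.aug = φ := by
    refine exists_comp_eq_of_ker_le _ C.aug_surj _ ?_
    rw [C.exact_aug]
    rintro _ ⟨x, rfl⟩
    exact LinearMap.congr_fun hφ x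
  let E : Abelian.Ext (ModuleCat.of R M) (ModuleCat.of R R) 0 ≃ₗ[R]
      (ModuleCat.of R M →ₗ[R] ModuleCat.of R R) :=
    Abelian.Ext.linearEquiv₀ ≪≫ₗ ModuleCat.homLinearEquiv
  have : Subsingleton (M →ₗ[R] R) := E.symm.toEquiv.subsingleton
  rw [Subsingleton.elim ψ 0, LinearMap.zero_comp]

theorem ker_dualMap_succ (C : MinFreeRes R M) (n : ℕ)
    (h : Subsingleton (Abelian.Ext (ModuleCat.of R M) (ModuleCat.of R R) (n + 1))) :
    LinearMap.ker (C.d (n + 1)).dualMap = LinearMap.range (C.d n).dualMap := by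
  ext φ
  constructor
  · intro hφ
    obtain ⟨δ, -, hδ⟩ := C.exists_hom_syz_linearMap_ext (ModuleCat.of R R) n
    obtain ⟨φ', rfl⟩ : ∃ φ' : C.Syz (n + 1) →ₗ[R] R, φ' ∘ₗ C.syzProj (n + 1) = φ := by
      refine exists_comp_eq_of_ker_le _ (C.syzProj_surjective _) _ ?_
      rw [C.ker_syzProj]
      rintro _ ⟨x, rfl⟩
      exact LinearMap.congr_fun hφ x
    obtain ⟨ψ, rfl⟩ := (hδ φ').1 (Subsingleton.elim _ _)
    exact ⟨ψ, rfl⟩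
  · rintro ⟨ψ, rfl⟩
    ext x
    simp [d_d]

theorem exists_dual_surjective (C : MinFreeRes R M) (r : ℕ)
    (e : Abelian.Ext (ModuleCat.of R M) (ModuleCat.of R R) r ≃ₗ[R] M)
    (h : HasProjectiveDimensionLT (ModuleCat.of R M) (r + 1)) :
    ∃ π : Module.Dual R (C.F r) →ₗ[R] M, Function.Surjective π ∧
      LinearMap.ker π ≤ maximalIdeal R • ⊤ ∧ ∀ q (hq : q + 1 = r),
      LinearMap.ker (hq ▸ π : Module.Dual R (C.F (q + 1)) →ₗ[R] M) =
        LinearMap.range (C.d q).dualMap := by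
  have := C.free
  have := C.fin
  let p : C.F r ≃ₗ[R] C.Syz r :=
    LinearEquiv.ofBijective (C.syzProj r) ⟨C.syzProj_injective h, C.syzProj_surjective r⟩
  obtain _ | n := r
  · let π : Module.Dual R (C.F 0) ≃ₗ[R] M := p.symm.dualMap ≪≫ₗ
      (Abelian.Ext.linearEquiv₀ (R := R) ≪≫ₗ ModuleCat.homLinearEquiv (S := R)).symm ≪≫ₗ e
    exact ⟨π.toLinearMap, π.surjective, by simp, fun q hq => by lia⟩
  · obtain ⟨δ, hδ, hk⟩ := C.exists_hom_syz_linearMap_ext (ModuleCat.of R R) n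
    let π : Module.Dual R (C.F (n + 1)) →ₗ[R] M :=
      e.toLinearMap ∘ₗ δ ∘ₗ p.symm.dualMap.toLinearMap
    have hπ : LinearMap.ker π = LinearMap.range (C.d n).dualMap := by
      ext φ
      have h1 : φ ∈ LinearMap.ker π ↔ δ (p.symm.dualMap φ) = 0 := e.map_eq_zero_iff
      rw [h1, hk, LinearMap.mem_range]
      refine exists_congr fun ψ => ⟨fun h => ?_, fun h => ?_⟩
      · ext x
        refine (LinearMap.congr_fun h (p x)).trans ?_
        exact congrArg φ (p.symm_apply_apply x)
      · ext y
        obtain ⟨x, rfl⟩ := p.surjective y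
        refine (LinearMap.congr_fun h x).trans ?_
        exact congrArg φ (p.symm_apply_apply x).symm
    refine ⟨π, e.surjective.comp (hδ.comp p.symm.dualMap.surjective), ?_, ?_⟩
    · rw [hπ]
      exact range_dualMap_le_smul_top _ _ (C.minimal n)
    · rintro q hq
      obtain rfl : q = n := by lia
      exact hπ

theorem selfDual_of_ext [Nontrivial M] (C : MinFreeRes R M) (r : ℕ)
    (h : HasProjectiveDimensionLT (ModuleCat.of R M) (r + 1))
    (h0 : ∀ j ≠ r, Subsingleton (Abelian.Ext (ModuleCat.of R M) (ModuleCat.of R R) j))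
    (e : Abelian.Ext (ModuleCat.of R M) (ModuleCat.of R R) r ≃ₗ[R] M) : C.SelfDual := by
  obtain ⟨π, hπ, hπm, hπk⟩ := C.exists_dual_surjective r e h
  have hd : C.d r = 0 := by
    rw [← LinearMap.range_eq_bot, ← C.ker_syzProj, LinearMap.ker_eq_bot]
    exact C.syzProj_injective h
  refine ⟨r, C.subsingleton_F_of_lt hd, ?_, C.exists_equiv_dual r
    (fun hr => C.ker_dualMap_zero (h0 0 (by lia)))
    (fun q hq => C.ker_dualMap_succ q (h0 _ (by lia))) π hπ hπm hπk⟩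
  by_contra hn
  rw [not_nontrivial_iff_subsingleton] at hn
  exact not_subsingleton M hπ.subsingleton

end MinFreeRes

theorem MinFreeRes.selfDual_of_isRegularLocal {R : Type} [CommRing R] [IsLocalRing R]
    [IsNoetherianRing R] (h : IsRegularLocal R) (C : MinFreeRes R (ResidueField R)) :
    C.SelfDual := by
  obtain ⟨d, hd, h0, ⟨e⟩⟩ := exists_ext_residueField_of_isRegularLocal h
  exact C.selfDual_of_ext d hd h0 e

section MinimalCover

variable {R : Type} [CommRing R] [IsLocalRing R]

noncomputable def minimalCoverRank (S : Type) [AddCommGroup S] [Module R S] [Module.Finite R S] :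
    ℕ := (exists_minimal_cover R S).choose

noncomputable def minimalCover (S : Type) [AddCommGroup S] [Module R S] [Module.Finite R S] :
    (Fin (minimalCoverRank (R := R) S) → R) →ₗ[R] S :=
  (exists_minimal_cover R S).choose_spec.choose

theorem minimalCover_surjective (S : Type) [AddCommGroup S] [Module R S] [Module.Finite R S] :
    Function.Surjective (minimalCover (R := R) S) :=
  (exists_minimal_cover R S).choose_spec.choose_spec.1

theorem ker_minimalCover_le (S : Type) [AddCommGroup S] [Module R S] [Module.Finite R S] :
    LinearMap.ker (minimalCover (R := R) S) ≤ maximalIdeal R • ⊤ :=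
  (exists_minimal_cover R S).choose_spec.choose_spec.2

/-- The modules obtained by iterating kernels of minimal covers. -/
noncomputable def minimalSyzygy [IsNoetherianRing R] (M : Type) [AddCommGroup M] [Module R M]
    [Module.Finite R M] : ℕ → {S : ModuleCat.{0} R // Module.Finite R S}
  | 0 => ⟨ModuleCat.of R M, ‹_›⟩
  | n + 1 =>
    haveI := (minimalSyzygy M n).2
    ⟨ModuleCat.of R (LinearMap.ker (minimalCover (R := R) (minimalSyzygy M n).1)),
      Module.IsNoetherian.finite R _⟩

instance [IsNoetherianRing R] (M : Type) [AddCommGroup M] [Module R M] [Module.Finite R M] (n : ℕ) :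
    Module.Finite R (minimalSyzygy (R := R) M n).1 :=
  (minimalSyzygy M n).2

/-- The inclusion of a module of `minimalSyzygy` into the free cover of the previous one. -/
noncomputable def minimalSyzygyIncl [IsNoetherianRing R] (M : Type) [AddCommGroup M] [Module R M]
    [Module.Finite R M] (n : ℕ) : (minimalSyzygy (R := R) M (n + 1)).1 →ₗ[R]
      (Fin (minimalCoverRank (R := R) (minimalSyzygy (R := R) M n).1) → R) :=
  (LinearMap.ker (minimalCover (R := R) (minimalSyzygy (R := R) M n).1)).subtype

/-- A chosen minimal free resolution of a finite module. -/
noncomputable def minimalResolution [IsNoetherianRing R] (M : Type) [AddCommGroup M] [Module R M]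
    [Module.Finite R M] : MinFreeRes R M :=
  have hr (n : ℕ) : LinearMap.range (minimalSyzygyIncl M n ∘ₗ
      minimalCover (R := R) (minimalSyzygy (R := R) M (n + 1)).1) =
      LinearMap.ker (minimalCover (R := R) (minimalSyzygy (R := R) M n).1) :=
    (LinearMap.range_comp_of_range_eq_top _
      (LinearMap.range_eq_top.2 (minimalCover_surjective _))).trans (Submodule.range_subtype _)
  { F n := ModuleCat.of R (Fin (minimalCoverRank (R := R) (minimalSyzygy (R := R) M n).1) → R)
    free _ := inferInstanceAs (Module.Free R (Fin _ → R))
    fin _ := inferInstanceAs (Module.Finite R (Fin _ → R))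
    d n := minimalSyzygyIncl M n ∘ₗ minimalCover (R := R) (minimalSyzygy (R := R) M (n + 1)).1
    aug := minimalCover (R := R) M
    aug_surj := minimalCover_surjective M
    exact_aug := (hr 0).symm
    exact n := (LinearMap.ker_comp_of_ker_eq_bot _ (Submodule.ker_subtype _)).trans
      (hr (n + 1)).symm
    minimal n := (hr n).trans_le (ker_minimalCover_le _) }

end MinimalCover

theorem MinFreeRes.exists_hasProjectiveDimensionLT {R : Type} [CommRing R] [IsLocalRing R]
    {M : Type} [AddCommGroup M] [Module R M] (C : MinFreeRes R M) {r : ℕ}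
    (h : ∀ n, r < n → Subsingleton (C.F n)) :
    ∃ n : ℕ, HasProjectiveDimensionLT (ModuleCat.of R M) (n + 1) := by
  have key (j : ℕ) : ∀ i, HasProjectiveDimensionLT (C.Syz i) (j + 1) →
      ∃ n : ℕ, HasProjectiveDimensionLT (ModuleCat.of R M) (n + 1) := by
    intro i
    induction i generalizing j with
    | zero => exact fun h => ⟨j, h⟩
    | succ i ih =>
      intro hi
      exact ih (j + 1) ((C.syzComplex_shortExact i).hasProjectiveDimensionLT_X₃ (j + 1) hi
        inferInstance)
  have := h (r + 1) r.lt_succ_self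
  have hs : Subsingleton (C.Syz (r + 1)) := (C.syzProj_surjective (r + 1)).subsingleton
  have hz : HasProjectiveDimensionLT (C.Syz (r + 1)) 0 :=
    (hasProjectiveDimensionLT_zero_iff_isZero _).2 (ModuleCat.isZero_of_subsingleton _)
  exact key 0 (r + 1) inferInstance

theorem LinearMap.shortExact_kerSubtype {R M N : Type} [CommRing R] [AddCommGroup M] [Module R M]
    [AddCommGroup N] [Module R N] (p : M →ₗ[R] N) (hp : Function.Surjective p) :
    (ShortComplex.mk (ModuleCat.ofHom (LinearMap.ker p).subtype) (ModuleCat.ofHom p)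
      (by ext x; exact x.2)).ShortExact :=
  ModuleCat.shortComplex_shortExact _ (LinearMap.exact_subtype_ker_map p)
    (Submodule.injective_subtype _) hp

theorem hasProjectiveDimensionLT_ker {R M N : Type} [CommRing R] [AddCommGroup M] [Module R M]
    [AddCommGroup N] [Module R N] [Module.Projective R M] (p : M →ₗ[R] N)
    (hp : Function.Surjective p) (n : ℕ)
    (h : HasProjectiveDimensionLT (ModuleCat.of R N) (n + 2)) :
    HasProjectiveDimensionLT (ModuleCat.of R (LinearMap.ker p)) (n + 1) :=
  ((p.shortExact_kerSubtype hp).hasProjectiveDimensionLT_X₃_iff n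
    ((IsProjective.iff_projective M).1 inferInstance)).1 h

theorem free_of_hasProjectiveDimensionLT_one {R M : Type} [CommRing R] [IsLocalRing R]
    [AddCommGroup M] [Module R M] [Module.Finite R M]
    (h : HasProjectiveDimensionLT (ModuleCat.of R M) 1) : Module.Free R M := by
  have := (IsProjective.iff_projective M).2 (projective_iff_hasProjectiveDimensionLT_one.2 h)
  exact Module.free_of_flat_of_isLocalRing

theorem free_of_hasProjectiveDimensionLT_of_mul_eq_zero {R : Type} [CommRing R] [IsLocalRing R]
    [IsNoetherianRing R] {s : R} (hs0 : s ≠ 0) (hs : ∀ x ∈ maximalIdeal R, s * x = 0) (n : ℕ) :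
    ∀ (M : Type) [AddCommGroup M] [Module R M] [Module.Finite R M],
      HasProjectiveDimensionLT (ModuleCat.of R M) (n + 1) → Module.Free R M := by
  induction n with
  | zero => exact fun M _ _ _ h => free_of_hasProjectiveDimensionLT_one h
  | succ n ih =>
    intro M _ _ _ h
    obtain ⟨k, p, hp, hk⟩ := exists_minimal_cover R M
    have hfree := ih _ (hasProjectiveDimensionLT_ker p hp n h)
    have hann (y : LinearMap.ker p) : s • y = 0 := by
      have : (maximalIdeal R • ⊤ : Submodule R (Fin k → R)) ≤
          LinearMap.ker (LinearMap.lsmul R (Fin k → R) s) := by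
        refine Submodule.smul_le.2 fun r hr v _ => ?_
        rw [LinearMap.mem_ker, LinearMap.lsmul_apply, smul_smul, hs r hr, zero_smul]
      exact Subtype.ext (this (hk y.2))
    have hb : IsEmpty (Module.Free.ChooseBasisIndex R (LinearMap.ker p)) := by
      refine ⟨fun i => hs0 ?_⟩
      have := congrArg (fun y => (Module.Free.chooseBasis R (LinearMap.ker p)).repr y i)
        (hann (Module.Free.chooseBasis R (LinearMap.ker p) i))
      simpa using this
    have hsub : Subsingleton (LinearMap.ker p) :=
      (Module.Free.chooseBasis R (LinearMap.ker p)).repr.toEquiv.subsingleton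
    have hinj : Function.Injective p :=
      LinearMap.ker_eq_bot.1 ((Submodule.subsingleton_iff_eq_bot).1 hsub)
    exact Module.Free.of_equiv (LinearEquiv.ofBijective p ⟨hinj, hp⟩)

theorem maximalIdeal_eq_bot_of_hasProjectiveDimensionLT {R : Type} [CommRing R] [IsLocalRing R]
    [IsNoetherianRing R] {s : R} (hs0 : s ≠ 0) (hs : ∀ x ∈ maximalIdeal R, s * x = 0) {n : ℕ}
    (h : HasProjectiveDimensionLT (ModuleCat.of R (ResidueField R)) (n + 1)) :
    maximalIdeal R = ⊥ := by
  have := free_of_hasProjectiveDimensionLT_of_mul_eq_zero hs0 hs n _ h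
  rw [eq_bot_iff]
  intro x hx
  let b := Module.Free.chooseBasis R (ResidueField R)
  obtain ⟨i⟩ := b.index_nonempty
  have h1 : x • b i = 0 := by
    rw [Algebra.smul_def, ResidueField.algebraMap_eq, (residue_eq_zero_iff x).2 hx, zero_mul]
  have h2 := congrArg (fun y => b.repr y i) h1
  simpa using h2

theorem projective_quotSMulTop {R M : Type*} [CommRing R] [AddCommGroup M] [Module R M]
    [Module.Projective R M] (x : R) :
    Module.Projective (R ⧸ Ideal.span {x}) (QuotSMulTop x M) :=
  Module.Projective.of_equiv ((QuotSMulTop.equivQuotTensor x M).extendScalarsOfSurjective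
    Ideal.Quotient.mk_surjective).symm

/-- The map induced on quotients modulo `x`, linear over `R ⧸ (x)`. -/
def quotSMulTopMap {R A B : Type*} [CommRing R] [AddCommGroup A] [Module R A] [AddCommGroup B]
    [Module R B] (x : R) (f : A →ₗ[R] B) :
    QuotSMulTop x A →ₗ[R ⧸ Ideal.span {x}] QuotSMulTop x B :=
  (QuotSMulTop.map x f).extendScalarsOfSurjective Ideal.Quotient.mk_surjective

theorem quotSMulTopMap_injective {R A B C : Type*} [CommRing R] [AddCommGroup A] [Module R A]
    [AddCommGroup B] [Module R B] [AddCommGroup C] [Module R C] {x : R} {f : A →ₗ[R] B}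
    {g : B →ₗ[R] C} (hf : Function.Injective f) (hfg : Function.Exact f g)
    (hC : IsSMulRegular C x) : Function.Injective (quotSMulTopMap x f) := by
  have h := QuotSMulTop.map_first_exact_on_four_term_exact_of_isSMulRegular_last
    (f₁ := (0 : A →ₗ[R] A)) ((LinearMap.exact_zero_iff_injective A f).2 hf) hfg hC
  rw [map_zero] at h
  exact (LinearMap.exact_zero_iff_injective _ (QuotSMulTop.map x f)).1 h

theorem quotSMulTop_shortExact {R A B C : Type} [CommRing R] [AddCommGroup A] [Module R A]
    [AddCommGroup B] [Module R B] [AddCommGroup C] [Module R C] {x : R} {f : A →ₗ[R] B}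
    {g : B →ₗ[R] C} (hf : Function.Injective f) (hfg : Function.Exact f g)
    (hg : Function.Surjective g) (hC : IsSMulRegular C x) :
    (ShortComplex.mk (ModuleCat.ofHom (quotSMulTopMap x f)) (ModuleCat.ofHom (quotSMulTopMap x g))
      (by
        ext1
        exact (show Function.Exact (quotSMulTopMap x f) (quotSMulTopMap x g) from
          QuotSMulTop.map_exact x hfg hg).linearMap_comp_eq_zero)).ShortExact :=
  ModuleCat.shortComplex_shortExact _ (QuotSMulTop.map_exact x hfg hg)
    (quotSMulTopMap_injective hf hfg hC) (QuotSMulTop.map_surjective x hg)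

theorem hasProjectiveDimensionLT_quotSMulTop {R : Type} [CommRing R] {x : R}
    (hx : IsSMulRegular R x) (n : ℕ) :
    ∀ (M : Type) [AddCommGroup M] [Module R M], IsSMulRegular M x →
      HasProjectiveDimensionLT (ModuleCat.of R M) (n + 1) →
      HasProjectiveDimensionLT (ModuleCat.of (R ⧸ Ideal.span {x}) (QuotSMulTop x M)) (n + 1) := by
  induction n with
  | zero =>
    intro M _ _ _ h
    have := (IsProjective.iff_projective M).2 (projective_iff_hasProjectiveDimensionLT_one.2 h)
    have := projective_quotSMulTop (M := M) x
    exact projective_iff_hasProjectiveDimensionLT_one.1 ((IsProjective.iff_projective _).1 this)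
  | succ n ih =>
    intro M _ _ hM h
    let p : (M →₀ R) →ₗ[R] M := Finsupp.linearCombination R id
    have hp : Function.Surjective p := Finsupp.linearCombination_id_surjective R M
    have hF : IsSMulRegular (M →₀ R) x := by
      intro a b hab
      ext i
      exact hx (DFunLike.congr_fun hab i)
    have hK := ih (LinearMap.ker p) (hF.submodule _ _) (hasProjectiveDimensionLT_ker p hp n h)
    have := projective_quotSMulTop (M := M →₀ R) x
    exact ((quotSMulTop_shortExact (Submodule.injective_subtype _)
      (LinearMap.exact_subtype_ker_map p) hp hM).hasProjectiveDimensionLT_X₃_iff n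
      ((IsProjective.iff_projective _).1 this)).2 hK

theorem exists_linearMap_residueField_apply_one {R N : Type*} [CommRing R] [IsLocalRing R]
    [AddCommGroup N] [Module R N] (v : N) (hv : ∀ a ∈ maximalIdeal R, a • v = 0) :
    ∃ i : ResidueField R →ₗ[R] N, i 1 = v := by
  obtain ⟨i, hi⟩ := exists_comp_eq_of_ker_le (Algebra.linearMap R (ResidueField R))
    residue_surjective (LinearMap.toSpanSingleton R N v) (fun a ha => by
      rw [LinearMap.mem_ker, LinearMap.toSpanSingleton_apply]
      exact hv a ((residue_eq_zero_iff a).1 ha))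
  refine ⟨i, ?_⟩
  have := LinearMap.congr_fun hi 1
  rwa [LinearMap.comp_apply, LinearMap.toSpanSingleton_apply, one_smul, Algebra.linearMap_apply,
    map_one] at this

theorem exists_linearMap_maximalIdeal_residueField {R : Type*} [CommRing R] [IsLocalRing R]
    {x : R} (hx : x ∈ maximalIdeal R) (hx2 : x ∉ maximalIdeal R ^ 2) :
    ∃ g : maximalIdeal R →ₗ[R] ResidueField R, g ⟨x, hx⟩ = 1 := by
  have h0 : (maximalIdeal R).toCotangent ⟨x, hx⟩ ≠ 0 := fun h =>
    hx2 ((Ideal.toCotangent_eq_zero _ _).1 h)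
  obtain ⟨f, hf⟩ := Module.Projective.exists_dual_eq_one (ResidueField R) (V := CotangentSpace R) h0
  exact ⟨(f.restrictScalars R) ∘ₗ (maximalIdeal R).toCotangent, hf⟩

open scoped Pointwise in
theorem exists_retract_residueField_quotSMulTop {R : Type} [CommRing R] [IsLocalRing R] {x : R}
    (hx : x ∈ maximalIdeal R) (hx2 : x ∉ maximalIdeal R ^ 2)
    [IsLocalRing (R ⧸ Ideal.span {x})] :
    Nonempty (Retract (ModuleCat.of (R ⧸ Ideal.span {x}) (ResidueField (R ⧸ Ideal.span {x})))
      (ModuleCat.of (R ⧸ Ideal.span {x}) (QuotSMulTop x (maximalIdeal R)))) := by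
  have := IsLocalHom.of_surjective (Ideal.Quotient.mk (Ideal.span {x})) Ideal.Quotient.mk_surjective
  have hcm := maximalIdeal_comap (Ideal.Quotient.mk (Ideal.span {x}))
  obtain ⟨i, hi⟩ := exists_linearMap_residueField_apply_one (R := R ⧸ Ideal.span {x})
    (N := QuotSMulTop x (maximalIdeal R)) (Submodule.Quotient.mk ⟨x, hx⟩) (fun s hs => by
      obtain ⟨a, rfl⟩ := Ideal.Quotient.mk_surjective s
      have ha : a ∈ maximalIdeal R := by rw [← hcm]; exact hs
      change Submodule.Quotient.mk (a • (⟨x, hx⟩ : maximalIdeal R)) = 0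
      rw [Submodule.Quotient.mk_eq_zero]
      refine (Submodule.mem_smul_pointwise_iff_exists _ _ _).2 ⟨⟨a, ha⟩, trivial, ?_⟩
      exact Subtype.ext (mul_comm x a))
  obtain ⟨g, hg⟩ := exists_linearMap_maximalIdeal_residueField hx hx2
  obtain ⟨ψ, hψ⟩ := exists_linearMap_residueField_apply_one (R := R)
    (N := ResidueField (R ⧸ Ideal.span {x})) 1 (fun a ha => by
      rw [Algebra.smul_def, mul_one]
      refine (residue_eq_zero_iff (Ideal.Quotient.mk (Ideal.span {x}) a)).2 ?_
      rw [← hcm] at ha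
      exact ha)
  obtain ⟨r, hr⟩ := exists_comp_eq_of_ker_le (x • (⊤ : Submodule R (maximalIdeal R))).mkQ
    (Submodule.mkQ_surjective _) (ψ ∘ₗ g) (by
      rw [Submodule.ker_mkQ]
      intro y hy
      obtain ⟨z, -, rfl⟩ := (Submodule.mem_smul_pointwise_iff_exists _ _ _).1 hy
      have h1 : x • g z = 0 := by
        rw [Algebra.smul_def]
        exact mul_eq_zero_of_left ((residue_eq_zero_iff x).2 hx) _
      rw [LinearMap.mem_ker, LinearMap.comp_apply, map_smul, h1, map_zero])
  let r' : QuotSMulTop x (maximalIdeal R) →ₗ[R ⧸ Ideal.span {x}]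
    ResidueField (R ⧸ Ideal.span {x}) :=
    r.extendScalarsOfSurjective Ideal.Quotient.mk_surjective
  have h1 : r' (i 1) = 1 := by
    rw [hi]
    have := LinearMap.congr_fun hr ⟨x, hx⟩
    rw [LinearMap.comp_apply, LinearMap.comp_apply, hg, hψ] at this
    exact this
  refine ⟨⟨ModuleCat.ofHom i, ModuleCat.ofHom r', ?_⟩⟩
  ext1
  refine LinearMap.ext fun y => ?_
  obtain ⟨s, rfl⟩ := residue_surjective y
  have h2 : residue (R ⧸ Ideal.span {x}) s = s • (1 : ResidueField (R ⧸ Ideal.span {x})) := by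
    rw [Algebra.smul_def, mul_one]; rfl
  change r' (i _) = _
  rw [h2, map_smul, map_smul, h1]
  rfl

theorem exists_isSMulRegular_of_hasProjectiveDimensionLT {R : Type} [CommRing R] [IsLocalRing R]
    [IsNoetherianRing R] (hm : maximalIdeal R ≠ ⊥) {n : ℕ}
    (h : HasProjectiveDimensionLT (ModuleCat.of R (ResidueField R)) (n + 1)) :
    ∃ x ∈ maximalIdeal R, x ∉ maximalIdeal R ^ 2 ∧ IsSMulRegular R x := by
  obtain ⟨x, hx, hx2, hxp⟩ := exists_mem_maximalIdeal_notMem_sq hm (associatedPrimes R R)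
    (associatedPrimes.finite R R) (fun p hp => ⟨hp.1, fun hle => by
      obtain ⟨hprime, s, hs⟩ := isAssociatedPrime_iff.1 hp
      refine hm (maximalIdeal_eq_bot_of_hasProjectiveDimensionLT (s := s) ?_ (fun y hy => ?_) h)
      · rintro rfl
        refine hprime.ne_top (hs.trans ?_)
        rw [Ideal.eq_top_iff_one, Submodule.mem_colon_singleton, smul_zero]
        exact zero_mem _
      · have := hle hy
        rw [hs, Submodule.mem_colon_singleton] at this
        rw [mul_comm]
        exact this⟩)
  refine ⟨x, hx, hx2, ?_⟩
  by_contra hreg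
  have : x ∈ ⋃ p ∈ associatedPrimes R R, (p : Set R) := by
    rw [biUnion_associatedPrimes_eq_compl_regular]
    exact hreg
  obtain ⟨p, hp, hxp'⟩ := Set.mem_iUnion₂.1 this
  exact hxp p hp hxp'

theorem hasProjectiveDimensionLT_maximalIdeal {R : Type} [CommRing R] [IsLocalRing R] {n : ℕ}
    (h : HasProjectiveDimensionLT (ModuleCat.of R (ResidueField R)) (n + 1)) :
    HasProjectiveDimensionLT (ModuleCat.of R (maximalIdeal R)) (n + 1) := by
  have h' := hasProjectiveDimensionLT_ker (Algebra.linearMap R (ResidueField R))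
    residue_surjective n (hasProjectiveDimensionLT_of_ge _ (n + 1) (n + 2) (by lia))
  have e : LinearMap.ker (Algebra.linearMap R (ResidueField R)) = maximalIdeal R :=
    Ideal.mk_ker
  exact hasProjectiveDimensionLT_of_iso (LinearEquiv.ofEq _ _ e).toModuleIso (n + 1)

theorem exists_span_range_eq_maximalIdeal {R : Type*} [CommRing R] [IsLocalRing R] {x : R}
    [IsLocalRing (R ⧸ Ideal.span {x})] {n : ℕ} (t : Fin n → R ⧸ Ideal.span {x})
    (ht : Ideal.span (Set.range t) = maximalIdeal (R ⧸ Ideal.span {x})) :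
    ∃ s : Fin (n + 1) → R, Ideal.span (Set.range s) = maximalIdeal R := by
  obtain ⟨t, rfl⟩ := Ideal.Quotient.mk_surjective.comp_left t
  refine ⟨Fin.cons x t, ?_⟩
  have := IsLocalHom.of_surjective (Ideal.Quotient.mk (Ideal.span {x})) Ideal.Quotient.mk_surjective
  change Ideal.span (Set.range (Ideal.Quotient.mk (Ideal.span {x}) ∘ t)) = _ at ht
  rw [Set.range_comp, ← Ideal.map_span] at ht
  rw [← maximalIdeal_comap (Ideal.Quotient.mk (Ideal.span {x})), ← ht,
    Ideal.comap_map_of_surjective' _ Ideal.Quotient.mk_surjective, Ideal.mk_ker, sup_comm,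
    Fin.range_cons, Ideal.span_insert]

theorem exists_span_range_eq_maximalIdeal_of_hasProjectiveDimensionLT (d : ℕ) :
    ∀ (R : Type) [CommRing R] [IsLocalRing R] [IsNoetherianRing R] (n : ℕ),
      ringKrullDim R = d → HasProjectiveDimensionLT (ModuleCat.of R (ResidueField R)) (n + 1) →
      ∃ s : Fin d → R, Ideal.span (Set.range s) = maximalIdeal R := by
  induction d with
  | zero =>
    intro R _ _ _ n hd h
    refine ⟨![], ?_⟩
    rw [Set.range_eq_empty, Ideal.span_empty]
    by_contra! hm
    obtain ⟨x, hx, -, hreg⟩ := exists_isSMulRegular_of_hasProjectiveDimensionLT hm.symm h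
    have hloc := isLocalRing_quotient_span_singleton hx
    have hd' := ringKrullDim_quotient_span_singleton_succ_eq_ringKrullDim hreg hx
    have := ringKrullDim_nonneg_of_nontrivial (R := R ⧸ Ideal.span {x})
    rw [hd] at hd'
    have h1 : (1 : WithBot ℕ∞) ≤ 0 := by
      refine (le_add_of_nonneg_left this).trans hd'.le
    exact absurd h1 (by norm_num)
  | succ d ih =>
    intro R _ _ _ n hd h
    have hm : maximalIdeal R ≠ ⊥ := by
      intro hm
      have := ringKrullDim_le_of_span_range_eq (R := R) (n := 0) ![]
        (by rw [hm, Set.range_eq_empty, Ideal.span_empty])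
      rw [hd] at this
      exact absurd this (by norm_cast)
    obtain ⟨x, hx, hx2, hreg⟩ := exists_isSMulRegular_of_hasProjectiveDimensionLT hm h
    have hloc := isLocalRing_quotient_span_singleton hx
    have hd' := ringKrullDim_quotient_span_singleton_succ_eq_ringKrullDim hreg hx
    have h1 := hasProjectiveDimensionLT_quotSMulTop hreg n (maximalIdeal R) (hreg.submodule _ _)
      (hasProjectiveDimensionLT_maximalIdeal h)
    obtain ⟨ρ⟩ := exists_retract_residueField_quotSMulTop hx hx2
    have h2 := ρ.hasProjectiveDimensionLT (n + 1)
    obtain ⟨t, ht⟩ := ih (R ⧸ Ideal.span {x}) n (by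
      rw [hd, Nat.cast_succ] at hd'
      exact le_antisymm (ENat.WithBot.add_le_add_one_right_iff.1 hd'.le)
        (ENat.WithBot.add_le_add_one_right_iff.1 hd'.ge)) h2
    exact exists_span_range_eq_maximalIdeal t ht

theorem isRegularLocal_of_hasProjectiveDimensionLT {R : Type} [CommRing R] [IsLocalRing R]
    [IsNoetherianRing R] {n : ℕ}
    (h : HasProjectiveDimensionLT (ModuleCat.of R (ResidueField R)) (n + 1)) :
    IsRegularLocal R := by
  classical
  obtain ⟨d, hd⟩ : ∃ d : ℕ, ringKrullDim R = d := by
    obtain ⟨d, hd⟩ := WithBot.ne_bot_iff_exists.1 (ringKrullDim_ne_bot (R := R))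
    obtain ⟨e, rfl⟩ := ENat.ne_top_iff_exists.1
      (show d ≠ ⊤ by rintro rfl; exact ringKrullDim_ne_top hd.symm)
    exact ⟨e, hd.symm⟩
  obtain ⟨s, hs⟩ := exists_span_range_eq_maximalIdeal_of_hasProjectiveDimensionLT d R n hd h
  refine ⟨Finset.univ.image s, by simpa using hs, le_antisymm ?_ ?_⟩
  · rw [hd]
    exact_mod_cast Finset.card_image_le.trans_eq (Finset.card_fin d)
  · refine (ringKrullDim_le_spanFinrank_maximalIdeal R).trans ?_
    rw [← hs]
    have := Submodule.spanFinrank_span_le_ncard_of_finite (R := R) (Set.finite_range s)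
    rw [← Set.image_univ, ← Finset.coe_univ, ← Finset.coe_image, Set.ncard_coe_finset] at this
    rw [← Set.image_univ, ← Finset.coe_univ, ← Finset.coe_image]
    exact_mod_cast this

/-- A noetherian local ring `R` is regular iff the minimal free resolution of its
residue field is self-dual. -/
theorem stmt_13 (R : Type) [CommRing R] [IsLocalRing R] [IsNoetherianRing R] :
    IsRegularLocal R ↔ ∀ C : MinFreeRes R (ResidueField R), C.SelfDual := by
  refine ⟨fun h C => C.selfDual_of_isRegularLocal h, fun h => ?_⟩
  obtain ⟨r, hr, -⟩ := h (minimalResolution (ResidueField R))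
  obtain ⟨n, hn⟩ := (minimalResolution (R := R) (ResidueField R)).exists_hasProjectiveDimensionLT hr
  exact isRegularLocal_of_hasProjectiveDimensionLT hn
end
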